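/- (Quantitative lower bound, boundary version) Fix Λ, M, η, d₀ > 0 and a positive integer m. Assume Ω has the uniform interior cone property and satisfies the broken-line condition with parameter m. There exist constants c > 0 and r* > 0, depending only on n, Ω, A, Λ, M, η, d₀ and m, such that: for every measurable q with ‖q‖_{L^∞(Ω)} ≤ Λ and every u ∈ C²(Ω) ∩ C¹(closure(Ω)) that is a classical solution of L_q u = 0 with ‖u‖_{C¹(closure(Ω))} ≤ M and |u(x)| ≥ η whenever x ∈ closure(Ω) and dist(x, ∂Ω) ≤ d₀, one has exp(−c e^{c/r}) ≤ ‖u‖_{H¹(B(x,r) ∩ Ω)} for every x ∈ closure(Ω) and every r with 0 < r ≤ r*. -/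

import Mathlib

open MeasureTheory Metric Set
open scoped RealInnerProductSpace

noncomputable section

/-- The `i`-th partial derivative of a real-valued function on `ℝⁿ`. -/
noncomputable def pd {n : ℕ} (i : Fin n) (f : EuclideanSpace ℝ (Fin n) → ℝ)
    (x : EuclideanSpace ℝ (Fin n)) : ℝ :=
  fderiv ℝ f x (EuclideanSpace.single i 1)

/-- `u` is a classical solution of `L_q u = ∑ᵢⱼ ∂ᵢ (aⁱʲ ∂ⱼ u) + q u = 0` pointwise in `Ω`. -/
def IsSolution {n : ℕ} (A : Fin n → Fin n → EuclideanSpace ℝ (Fin n) → ℝ)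
    (q u : EuclideanSpace ℝ (Fin n) → ℝ) (Ω : Set (EuclideanSpace ℝ (Fin n))) : Prop :=
  ∀ x ∈ Ω, (∑ i, ∑ j, pd i (fun y => A i j y * pd j u y) x) + q x * u x = 0

/-- The `H¹(D)` norm `(∫_D (w² + ‖∇w‖²))^{1/2}`. -/
noncomputable def H1Norm {n : ℕ} (D : Set (EuclideanSpace ℝ (Fin n)))
    (w : EuclideanSpace ℝ (Fin n) → ℝ) : ℝ :=
  (∫ x in D, ((w x) ^ 2 + ‖fderiv ℝ w x‖ ^ 2)) ^ (1 / 2 : ℝ)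

/-- `A = (aⁱʲ)` is symmetric, has `C¹` entries on `closure Ω`, and is uniformly elliptic. -/
def EllipticSym {n : ℕ} (Ω : Set (EuclideanSpace ℝ (Fin n)))
    (A : Fin n → Fin n → EuclideanSpace ℝ (Fin n) → ℝ) : Prop :=
  (∀ i j, ∀ x ∈ closure Ω, A i j x = A j i x) ∧
  (∀ i j, ContDiffOn ℝ 1 (A i j) (closure Ω)) ∧
  (∃ lam > 0, ∀ x ∈ Ω, ∀ ξ : EuclideanSpace ℝ (Fin n),
    lam * ‖ξ‖ ^ 2 ≤ ∑ i, ∑ j, A i j x * ξ i * ξ j)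

/-- Uniform interior cone property of `Ω`. -/
def UniformIntConeProperty {n : ℕ} (Ω : Set (EuclideanSpace ℝ (Fin n))) : Prop :=
  ∃ R > 0, ∃ θ₀ : ℝ, 0 < θ₀ ∧ θ₀ < Real.pi / 2 ∧
    ∀ xt ∈ frontier Ω, ∃ ξ : EuclideanSpace ℝ (Fin n), ‖ξ‖ = 1 ∧
      {x : EuclideanSpace ℝ (Fin n) |
        ‖x - xt‖ < 2 * R ∧ ‖x - xt‖ * Real.cos θ₀ < ⟪x - xt, ξ⟫} ⊆ Ω

/-- Any two points of `D` can be joined by a broken line in `D` with at most `m` segments. -/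
def BrokenLineCond {n : ℕ} (D : Set (EuclideanSpace ℝ (Fin n))) (m : ℕ) : Prop :=
  ∀ x ∈ D, ∀ y ∈ D, ∃ j ≤ m, ∃ z : ℕ → EuclideanSpace ℝ (Fin n),
    z 0 = x ∧ z j = y ∧ ∀ i < j, segment ℝ (z i) (z (i + 1)) ⊆ D

/-- `u ∈ C¹(closure Ω)` with `‖u‖_{C¹(closure Ω)} ≤ M`. -/
def C1BoundOn {n : ℕ} (Ω : Set (EuclideanSpace ℝ (Fin n)))
    (u : EuclideanSpace ℝ (Fin n) → ℝ) (M : ℝ) : Prop :=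
  ContDiffOn ℝ 1 u (closure Ω) ∧ (∀ x ∈ closure Ω, |u x| ≤ M) ∧
    ∀ x ∈ Ω, ‖fderiv ℝ u x‖ ≤ M

/-! ### Elementary calculus of partial derivatives -/

abbrev Eu (n : ℕ) := EuclideanSpace ℝ (Fin n)

/-- `f` is differentiable at `x` with partial derivatives `d`. -/
def HP {n : ℕ} (f : Eu n → ℝ) (x : Eu n) (d : Fin n → ℝ) : Prop :=
  DifferentiableAt ℝ f x ∧ ∀ i, pd i f x = d i

namespace HP
variable {n : ℕ} {f g : Eu n → ℝ} {x : Eu n} {d e : Fin n → ℝ}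

lemma congr_d (h : HP f x d) (he : ∀ i, d i = e i) : HP f x e :=
  ⟨h.1, fun i => (h.2 i).trans (he i)⟩

lemma of_diff (h : DifferentiableAt ℝ f x) : HP f x (fun i => pd i f x) := ⟨h, fun _ => rfl⟩

lemma const (c : ℝ) : HP (fun _ : Eu n => c) x (fun _ => 0) :=
  ⟨differentiableAt_const c, fun i => by simp [pd]⟩

lemma add (hf : HP f x d) (hg : HP g x e) : HP (fun y => f y + g y) x (fun i => d i + e i) :=
  ⟨hf.1.add hg.1, fun i => by
    beta_reduce; rw [← hf.2, ← hg.2]; unfold pd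
    rw [show (fun y => f y + g y) = f + g from rfl, fderiv_add hf.1 hg.1]; rfl⟩

lemma sub (hf : HP f x d) (hg : HP g x e) : HP (fun y => f y - g y) x (fun i => d i - e i) :=
  ⟨hf.1.sub hg.1, fun i => by
    beta_reduce; rw [← hf.2, ← hg.2]; unfold pd
    rw [show (fun y => f y - g y) = f - g from rfl, fderiv_sub hf.1 hg.1]; rfl⟩

lemma mul (hf : HP f x d) (hg : HP g x e) :
    HP (fun y => f y * g y) x (fun i => d i * g x + f x * e i) :=
  ⟨hf.1.mul hg.1, fun i => by
    beta_reduce; rw [← hf.2, ← hg.2]; unfold pd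
    rw [show (fun y => f y * g y) = f * g from rfl, fderiv_mul hf.1 hg.1]
    simp; ring⟩

lemma const_mul (c : ℝ) (hf : HP f x d) : HP (fun y => c * f y) x (fun i => c * d i) :=
  ((const c).mul hf).congr_d fun i => by simp

lemma comp {φ : ℝ → ℝ} {φ' : ℝ} (hf : HP f x d) (hφ : HasDerivAt φ φ' (f x)) :
    HP (fun y => φ (f y)) x (fun i => φ' * d i) :=
  ⟨hφ.differentiableAt.comp x hf.1, fun i => by
    beta_reduce; rw [← hf.2]; unfold pd
    have := (hφ.comp_hasFDerivAt x hf.1.hasFDerivAt).fderiv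
    rw [show (fun y => φ (f y)) = φ ∘ f from rfl, this]; simp⟩

lemma sum {ι : Type*} [Fintype ι] {F : ι → Eu n → ℝ} {D : ι → Fin n → ℝ}
    (h : ∀ k, HP (F k) x (D k)) : HP (fun y => ∑ k, F k y) x (fun i => ∑ k, D k i) := by
  refine ⟨DifferentiableAt.fun_sum fun k _ => (h k).1, fun i => ?_⟩
  unfold pd
  rw [fderiv_fun_sum fun k _ => (h k).1]
  simp only [sum_apply]
  exact Finset.sum_congr rfl fun k _ => (h k).2 i

lemma coord (x0 : Eu n) (k : Fin n) :
    HP (fun y : Eu n => y k - x0 k) x (fun i => if k = i then 1 else 0) := by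
  have h : HasFDerivAt (fun y : Eu n => y k - x0 k) (EuclideanSpace.proj k : Eu n →L[ℝ] ℝ) x :=
    ((EuclideanSpace.proj k : Eu n →L[ℝ] ℝ).hasFDerivAt).sub_const _
  refine ⟨h.differentiableAt, fun i => ?_⟩
  unfold pd
  rw [h.fderiv]
  simp

lemma congr_f (hf : HP f x d) (h : g =ᶠ[nhds x] f) : HP g x d :=
  ⟨hf.1.congr_of_eventuallyEq h, fun i => by
    beta_reduce; rw [← hf.2]; unfold pd; rw [h.fderiv_eq]⟩

end HP

/-! ### The pointwise Rellich-type identity -/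

lemma rellich_alg {n : ℕ} (hn : n = 2 ∨ n = 3) (σ v h p : ℝ) (a : Fin n → Fin n → ℝ)
    (da : Fin n → Fin n → Fin n → ℝ) (g X dh dp : Fin n → ℝ) (D dX : Fin n → Fin n → ℝ)
    (ha : ∀ i j, a i j = a j i) (hD : ∀ i j, D i j = D j i) :
    (∑ i, ((-2 * ((∑ k, (dX i k * g k + X k * D i k)) * (∑ j, a i j * g j)
        + (∑ k, X k * g k) * (∑ j, (da i i j * g j + a i j * D i j)))
      + ((∑ k, (D i k * (∑ j, a k j * g j) + g k * (∑ j, (da i k j * g j + a k j * D i j)))) * X i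
        + (∑ k, g k * (∑ j, a k j * g j)) * dX i i)
      - ((dh i * v + h * g i) * (∑ j, a i j * g j)
        + (h * v) * (∑ j, (da i i j * g j + a i j * D i j))))
      - σ * (((dp i * v + p * g i) * v + (p * v) * g i) * X i + ((p * v) * v) * dX i i)))
    + (2 * (∑ i, ∑ k, (∑ j, a i j * g j) * dX i k * g k)
      + (h - ∑ i, dX i i) * (∑ k, g k * (∑ j, a k j * g j))
      - (∑ k, ∑ i, ∑ j, X k * da k i j * g i * g j)
      + v * (∑ i, (∑ j, a i j * g j) * dh i)
      + σ * v ^ 2 * ((∑ i, X i * dp i) + p * (∑ i, dX i i) - h * p))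
    = ((∑ i, ∑ j, (da i i j * g j + a i j * D i j)) + σ * p * v)
      * (-2 * (∑ k, X k * g k) - h * v) := by
  rcases hn with rfl | rfl
  · simp only [Fin.sum_univ_two]
    rw [ha 1 0, hD 1 0]
    ring
  · simp only [Fin.sum_univ_three]
    rw [ha 1 0, hD 1 0, ha 2 0, hD 2 0, ha 2 1, hD 2 1]
    ring


/-- The operator `∑ ∂ᵢ (aⁱʲ ∂ⱼ u)`. -/
def Lop {n : ℕ} (A : Fin n → Fin n → Eu n → ℝ) (u : Eu n → ℝ) (x : Eu n) : ℝ :=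
  ∑ i, ∑ j, pd i (fun y => A i j y * pd j u y) x

def VF {n : ℕ} (σ : ℝ) (A : Fin n → Fin n → Eu n → ℝ) (v : Eu n → ℝ) (X : Fin n → Eu n → ℝ)
    (h p : Eu n → ℝ) (i : Fin n) (y : Eu n) : ℝ :=
  (-2 * ((∑ k, X k y * pd k v y) * (∑ j, A i j y * pd j v y))
    + (∑ k, pd k v y * (∑ j, A k j y * pd j v y)) * X i y
    - (h y * v y) * (∑ j, A i j y * pd j v y))
  - σ * (((p y * v y) * v y) * X i y)

lemma rellich {n : ℕ} (hn : n = 2 ∨ n = 3) (σ : ℝ) (A : Fin n → Fin n → Eu n → ℝ)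
    (v h p : Eu n → ℝ) (X : Fin n → Eu n → ℝ) (x : Eu n)
    (da : Fin n → Fin n → Fin n → ℝ) (g dh dp : Fin n → ℝ) (D dX : Fin n → Fin n → ℝ)
    (hA : ∀ i j, HP (A i j) x (fun k => da k i j))
    (hv : HP v x g) (hg : ∀ j, HP (pd j v) x (fun i => D i j))
    (hX : ∀ k, HP (X k) x (fun i => dX i k)) (hh : HP h x dh) (hp : HP p x dp)
    (ha : ∀ i j, A i j x = A j i x) (hD : ∀ i j, D i j = D j i) :
    (∑ i, pd i (VF σ A v X h p i) x)
    + (2 * (∑ i, ∑ k, (∑ j, A i j x * g j) * dX i k * g k)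
      + (h x - ∑ i, dX i i) * (∑ k, g k * (∑ j, A k j x * g j))
      - (∑ k, ∑ i, ∑ j, X k x * da k i j * g i * g j)
      + v x * (∑ i, (∑ j, A i j x * g j) * dh i)
      + σ * v x ^ 2 * ((∑ i, X i x * dp i) + p x * (∑ i, dX i i) - h x * p x))
    = (Lop A v x + σ * p x * v x) * (-2 * (∑ k, X k x * g k) - h x * v x) := by
  have hg0 : ∀ k, pd k v x = g k := hv.2
  have hL : Lop A v x = ∑ i, ∑ j, (da i i j * g j + A i j x * D i j) := by
    unfold Lop
    refine Finset.sum_congr rfl fun i _ => Finset.sum_congr rfl fun j _ => ?_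
    rw [((hA i j).mul (hg j)).2 i, hg0]
  rw [hL, ← rellich_alg hn σ (v x) (h x) (p x) (fun i j => A i j x) da g (fun k => X k x) dh dp D dX
    ha hD]
  congr 1
  refine Finset.sum_congr rfl fun i _ => ?_
  have hF : ∀ i, HP (fun y => ∑ j, A i j y * pd j v y) x _ :=
    fun i => HP.sum fun j => (hA i j).mul (hg j)
  have h1 := (((((HP.sum fun k => (hX k).mul (hg k)).mul (hF i)).const_mul (-2)).add
    ((HP.sum fun k => (hg k).mul (hF k)).mul (hX i))).sub ((hh.mul hv).mul (hF i))).sub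
    ((((hp.mul hv).mul hv).mul (hX i)).const_mul σ)
  have h2 := h1.2 i
  simp only [hg0] at h2
  exact h2

/-! ### The weight -/

/-- `1 / (|y - x0|² + r²)` -/
def wE {n : ℕ} (x0 : Eu n) (r : ℝ) (y : Eu n) : ℝ := (∑ k, (y k - x0 k) * (y k - x0 k) + r ^ 2)⁻¹

def wY {n : ℕ} (A : Fin n → Fin n → Eu n → ℝ) (x0 : Eu n) (k : Fin n) (y : Eu n) : ℝ :=
  ∑ j, A k j y * (y j - x0 j)

def wQ {n : ℕ} (A : Fin n → Fin n → Eu n → ℝ) (x0 : Eu n) (y : Eu n) : ℝ :=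
  ∑ k, (y k - x0 k) * wY A x0 k y

def wX {n : ℕ} (N : ℕ) (A : Fin n → Fin n → Eu n → ℝ) (x0 : Eu n) (r : ℝ) (k : Fin n)
    (y : Eu n) : ℝ := -2 * N * ((wE x0 r y ^ N * wE x0 r y) * wY A x0 k y)

def wp {n : ℕ} (N : ℕ) (A : Fin n → Fin n → Eu n → ℝ) (x0 : Eu n) (r : ℝ) (y : Eu n) : ℝ :=
  4 * N ^ 2 * ((wE x0 r y ^ N * wE x0 r y) * (wE x0 r y ^ N * wE x0 r y) * wQ A x0 y)

def wh {n : ℕ} (N : ℕ) (A : Fin n → Fin n → Eu n → ℝ) (x0 : Eu n) (r : ℝ) (y : Eu n) : ℝ :=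
  8 * N ^ 2 * ((wE x0 r y ^ N * wE x0 r y) * wE x0 r y * wQ A x0 y)

lemma wE_pos {n : ℕ} (x0 : Eu n) {r : ℝ} (hr : 0 < r) (y : Eu n) : 0 < wE x0 r y := by
  unfold wE
  have : 0 ≤ ∑ k, (y k - x0 k) * (y k - x0 k) := Finset.sum_nonneg fun k _ => mul_self_nonneg _
  positivity

lemma HP_wE {n : ℕ} (x0 : Eu n) {r : ℝ} (hr : 0 < r) (x : Eu n) :
    HP (wE x0 r) x (fun i => -2 * (x i - x0 i) * wE x0 r x ^ 2) := by
  have h1 : HP (fun y : Eu n => ∑ k, (y k - x0 k) * (y k - x0 k) + r ^ 2) x _ :=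
    (HP.sum fun k => (HP.coord x0 k).mul (HP.coord x0 k)).add (HP.const (r ^ 2))
  have hpos := wE_pos x0 hr x
  have hne : (∑ k, (x k - x0 k) * (x k - x0 k) + r ^ 2) ≠ 0 := by
    intro h0
    unfold wE at hpos; rw [h0] at hpos; simp at hpos
  refine (h1.comp (hasDerivAt_inv hne)).congr_d fun i => ?_
  unfold wE
  simp [Finset.sum_add_distrib]
  field_simp
  ring

lemma HP_wP {n : ℕ} (x0 : Eu n) {r : ℝ} (hr : 0 < r) (x : Eu n) (N : ℕ) :
    HP (fun y => wE x0 r y ^ N) x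
      (fun i => -2 * N * (wE x0 r x ^ N * wE x0 r x) * (x i - x0 i)) := by
  refine ((HP_wE x0 hr x).comp (hasDerivAt_pow N _)).congr_d fun i => ?_
  rcases N with _ | N
  · simp
  · simp only [Nat.add_sub_cancel]; ring

lemma HP_wPE {n : ℕ} (x0 : Eu n) {r : ℝ} (hr : 0 < r) (x : Eu n) (N : ℕ) :
    HP (fun y => wE x0 r y ^ N * wE x0 r y) x
      (fun i => -2 * (N + 1) * (wE x0 r x ^ N * wE x0 r x ^ 2) * (x i - x0 i)) :=
  ((HP_wP x0 hr x N).mul (HP_wE x0 hr x)).congr_d fun i => by ring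

section
variable {n : ℕ} {A : Fin n → Fin n → Eu n → ℝ} {x x0 : Eu n}
  {da : Fin n → Fin n → Fin n → ℝ}

lemma HP_wY (hA : ∀ i j, HP (A i j) x (fun k => da k i j)) (k : Fin n) :
    HP (wY A x0 k) x (fun i => A k i x + ∑ j, da i k j * (x j - x0 j)) := by
  refine (HP.sum fun j => (hA k j).mul (HP.coord x0 j)).congr_d fun i => ?_
  simp [Finset.sum_add_distrib]; ring

lemma HP_wQ {dY : Fin n → Fin n → ℝ} (hY : ∀ k, HP (wY A x0 k) x (fun i => dY i k)) :
    HP (wQ A x0) x (fun i => wY A x0 i x + ∑ k, (x k - x0 k) * dY i k) := by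
  refine (HP.sum fun j => (HP.coord x0 j).mul (hY j)).congr_d fun i => ?_
  simp [Finset.sum_add_distrib]
end


lemma quad_alg {n : ℕ} (hn : n = 2 ∨ n = 3) (ν P e v σ : ℝ) (da : Fin n → Fin n → Fin n → ℝ)
    (g z Y F dQ : Fin n → ℝ) (dY : Fin n → Fin n → ℝ)
    (hW : ∑ i, z i * F i = ∑ i, Y i * g i) :
    2 * (∑ i, ∑ k, F i * (-2 * ν * ((-2 * (ν + 1) * (P * e ^ 2) * z i) * Y k + (P * e) * dY i k))
        * g k)
      + (8 * ν ^ 2 * ((P * e) * e * (∑ k, z k * Y k))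
          - ∑ i, (-2 * ν * ((-2 * (ν + 1) * (P * e ^ 2) * z i) * Y i + (P * e) * dY i i)))
        * (∑ k, g k * F k)
      - (∑ k, ∑ i, ∑ j, (-2 * ν * ((P * e) * Y k)) * da k i j * g i * g j)
      + v * (∑ i, F i * (8 * ν ^ 2 * (((-2 * (ν + 1) * (P * e ^ 2) * z i) * e
          + (P * e) * (-2 * z i * e ^ 2)) * (∑ k, z k * Y k) + (P * e) * e * dQ i)))
      + σ * v ^ 2 * ((∑ i, (-2 * ν * ((P * e) * Y i)) *
          (4 * ν ^ 2 * (((-2 * (ν + 1) * (P * e ^ 2) * z i) * (P * e)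
            + (P * e) * (-2 * (ν + 1) * (P * e ^ 2) * z i)) * (∑ k, z k * Y k)
            + (P * e) * (P * e) * dQ i)))
        + (4 * ν ^ 2 * ((P * e) * (P * e) * (∑ k, z k * Y k))) *
          (∑ i, (-2 * ν * ((-2 * (ν + 1) * (P * e ^ 2) * z i) * Y i + (P * e) * dY i i)))
        - (8 * ν ^ 2 * ((P * e) * e * (∑ k, z k * Y k)))
          * (4 * ν ^ 2 * ((P * e) * (P * e) * (∑ k, z k * Y k))))
    = 8 * ν * (ν + 1) * P * e ^ 2 * (∑ i, Y i * g i) ^ 2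
      + 4 * ν * (ν - 1) * P * e ^ 2 * (∑ k, z k * Y k) * (∑ k, g k * F k)
      + 2 * ν * P * e * (-2 * (∑ i, ∑ k, F i * dY i k * g k) + (∑ i, dY i i) * (∑ k, g k * F k)
          + ∑ k, ∑ i, ∑ j, Y k * da k i j * g i * g j)
      + v * (-16 * ν ^ 2 * (ν + 2) * P * e ^ 3 * (∑ k, z k * Y k) * (∑ i, Y i * g i)
          + 8 * ν ^ 2 * P * e ^ 2 * (∑ i, F i * dQ i))
      + σ * v ^ 2 * ((16 * ν ^ 4 + 48 * ν ^ 3) * P ^ 3 * e ^ 4 * (∑ k, z k * Y k) ^ 2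
          - 8 * ν ^ 3 * P ^ 3 * e ^ 3 * ((∑ i, Y i * dQ i)
            + (∑ k, z k * Y k) * (∑ i, dY i i))) := by
  rcases hn with rfl | rfl
  · simp only [Fin.sum_univ_two] at *
    linear_combination (8 * ν * (ν + 1) * P * e ^ 2 * (Y 0 * g 0 + Y 1 * g 1)
      - 16 * ν ^ 2 * (ν + 2) * P * e ^ 3 * v * (z 0 * Y 0 + z 1 * Y 1)) * hW
  · simp only [Fin.sum_univ_three] at *
    linear_combination (8 * ν * (ν + 1) * P * e ^ 2 * (Y 0 * g 0 + Y 1 * g 1 + Y 2 * g 2)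
      - 16 * ν ^ 2 * (ν + 2) * P * e ^ 3 * v * (z 0 * Y 0 + z 1 * Y 1 + z 2 * Y 2)) * hW

lemma sum_sym {n : ℕ} (a : Fin n → Fin n → ℝ) (z g : Fin n → ℝ) (ha : ∀ i j, a i j = a j i) :
    ∑ i, z i * (∑ j, a i j * g j) = ∑ i, (∑ j, a i j * z j) * g i := by
  simp only [Finset.mul_sum, Finset.sum_mul]
  rw [Finset.sum_comm]
  refine Finset.sum_congr rfl fun i _ => Finset.sum_congr rfl fun j _ => ?_
  rw [ha j i]; ring

lemma rellich_w {n : ℕ} (hn : n = 2 ∨ n = 3) (σ : ℝ) (N : ℕ) (A : Fin n → Fin n → Eu n → ℝ)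
    (v : Eu n → ℝ) (x x0 : Eu n) {r : ℝ} (hr : 0 < r)
    (da : Fin n → Fin n → Fin n → ℝ) (g : Fin n → ℝ) (D dY : Fin n → Fin n → ℝ) (dQ : Fin n → ℝ)
    (hA : ∀ i j, HP (A i j) x (fun k => da k i j))
    (hv : HP v x g) (hg : ∀ j, HP (pd j v) x (fun i => D i j))
    (ha : ∀ i j, A i j x = A j i x) (hD : ∀ i j, D i j = D j i)
    (hY : ∀ k, HP (wY A x0 k) x (fun i => dY i k)) (hQ : HP (wQ A x0) x dQ)
    (P e : ℝ) (he : e = wE x0 r x) (hP : P = e ^ N) (F Y z : Fin n → ℝ)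
    (hF : F = fun i => ∑ j, A i j x * g j) (hYd : Y = fun i => wY A x0 i x)
    (hz : z = fun i => x i - x0 i) :
    (∑ i, pd i (VF σ A v (wX N A x0 r) (wh N A x0 r) (wp N A x0 r) i) x)
    + (8 * N * (N + 1) * P * e ^ 2 * (∑ i, Y i * g i) ^ 2
      + 4 * N * (N - 1) * P * e ^ 2 * (∑ k, z k * Y k) * (∑ k, g k * F k)
      + 2 * N * P * e * (-2 * (∑ i, ∑ k, F i * dY i k * g k) + (∑ i, dY i i) * (∑ k, g k * F k)
          + ∑ k, ∑ i, ∑ j, Y k * da k i j * g i * g j)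
      + v x * (-16 * N ^ 2 * (N + 2) * P * e ^ 3 * (∑ k, z k * Y k) * (∑ i, Y i * g i)
          + 8 * N ^ 2 * P * e ^ 2 * (∑ i, F i * dQ i))
      + σ * v x ^ 2 * ((16 * N ^ 4 + 48 * N ^ 3) * P ^ 3 * e ^ 4 * (∑ k, z k * Y k) ^ 2
          - 8 * N ^ 3 * P ^ 3 * e ^ 3 * ((∑ i, Y i * dQ i)
            + (∑ k, z k * Y k) * (∑ i, dY i i))))
    = (Lop A v x + σ * wp N A x0 r x * v x) *
      (-2 * (∑ k, wX N A x0 r k x * g k) - wh N A x0 r x * v x) := by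
  have hW : ∑ i, z i * F i = ∑ i, Y i * g i := by
    rw [hF, hYd, hz]
    exact sum_sym (fun i j => A i j x) (fun i => x i - x0 i) g ha
  have hPE := HP_wPE x0 hr x N
  have hE := HP_wE x0 hr x
  have hX : ∀ k, HP (wX N A x0 r k) x _ := fun k => (hPE.mul (hY k)).const_mul (-2 * N)
  have hp : HP (wp N A x0 r) x _ := ((hPE.mul hPE).mul hQ).const_mul (4 * N ^ 2)
  have hh : HP (wh N A x0 r) x _ := ((hPE.mul hE).mul hQ).const_mul (8 * N ^ 2)
  have key := rellich hn σ A v _ _ _ x da g _ _ D _ hA hv hg hX hh hp ha hD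
  rw [← key, ← quad_alg hn N P e (v x) σ da g z Y F dQ dY hW]
  subst hF hYd hz hP he
  rfl


/-! ### Conjugation with the weight -/

lemma pd_c1 {n : ℕ} {w : Eu n → ℝ} {x : Eu n} (hw : ContDiffAt ℝ 2 w x) (j : Fin n) :
    ContDiffAt ℝ 1 (pd j w) x := by
  have h : ContDiffAt ℝ 1 (fderiv ℝ w) x := hw.fderiv_right (by norm_num)
  exact h.clm_apply contDiffAt_const

lemma pd_symm {n : ℕ} {w : Eu n → ℝ} {x : Eu n} (hw : ContDiffAt ℝ 2 w x) (i j : Fin n) :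
    pd i (pd j w) x = pd j (pd i w) x := by
  have h : ContDiffAt ℝ 1 (fderiv ℝ w) x := hw.fderiv_right (by norm_num)
  have hd : DifferentiableAt ℝ (fderiv ℝ w) x := h.differentiableAt (by norm_num)
  have hs : IsSymmSndFDerivAt ℝ w x := hw.isSymmSndFDerivAt (by simp)
  have key : ∀ i j, pd i (pd j w) x
      = fderiv ℝ (fderiv ℝ w) x (EuclideanSpace.single i 1) (EuclideanSpace.single j 1) := by
    intro i j
    unfold pd
    rw [fderiv_clm_apply hd (differentiableAt_const _)]
    simp
  rw [key, key]
  exact hs _ _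

lemma pd_hp {n : ℕ} {w : Eu n → ℝ} {x : Eu n} (hw : ContDiffAt ℝ 2 w x) (j : Fin n) :
    HP (pd j w) x (fun i => pd i (pd j w) x) :=
  HP.of_diff ((pd_c1 hw j).differentiableAt (by norm_num))

lemma conj_alg {n : ℕ} (hn : n = 2 ∨ n = 3) (τ ρ w : ℝ) (a : Fin n → Fin n → ℝ)
    (da : Fin n → Fin n → Fin n → ℝ) (g dw f : Fin n → ℝ) (D Dw f2 : Fin n → Fin n → ℝ)
    (ha : ∀ i j, a i j = a j i)
    (hg : ∀ j, g j = ρ * (dw j + τ * f j * w))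
    (hD : ∀ i j, D i j = (ρ * τ * f i) * (dw j + τ * f j * w)
      + ρ * (Dw i j + τ * (f2 i j * w + f j * dw i))) :
    (∑ i, ∑ j, (da i i j * g j + a i j * D i j)) + τ ^ 2 * (∑ i, f i * (∑ j, a i j * f j)) * (ρ * w)
      - 2 * τ * ∑ k, (∑ j, a k j * f j) * g k
    = ρ * (∑ i, ∑ j, (da i i j * dw j + a i j * Dw i j))
      + τ * (∑ i, ∑ j, (da i i j * f j + a i j * f2 i j)) * (ρ * w) := by
  rcases hn with rfl | rfl
  · simp only [Fin.sum_univ_two, hg, hD]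
    rw [ha 1 0]
    ring
  · simp only [Fin.sum_univ_three, hg, hD]
    rw [ha 1 0, ha 2 0, ha 2 1]
    ring

lemma conj_w {n : ℕ} (hn : n = 2 ∨ n = 3) (τ : ℝ) (N : ℕ) (A : Fin n → Fin n → Eu n → ℝ)
    (w v : Eu n → ℝ) (x x0 : Eu n) {r : ℝ} (hr : 0 < r)
    (da : Fin n → Fin n → Fin n → ℝ)
    (hA : ∀ i j, HP (A i j) x (fun k => da k i j))
    (ha : ∀ i j, A i j x = A j i x) (hw : ContDiffAt ℝ 2 w x)
    (hv : v = fun y => Real.exp (τ * wE x0 r y ^ N) * w y)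
    (P e : ℝ) (he : e = wE x0 r x) (hP : P = e ^ N) (Y z : Fin n → ℝ)
    (hYd : Y = fun i => wY A x0 i x)
    (hz : z = fun i => x i - x0 i) :
    (∀ j, pd j v x = Real.exp (τ * P) * (pd j w x + τ * (-2 * N * (P * e) * z j) * w x)) ∧
    (Lop A v x + τ ^ 2 * wp N A x0 r x * v x) +
      τ * (-2 * (∑ k, wX N A x0 r k x * pd k v x) - wh N A x0 r x * v x)
    = Real.exp (τ * P) * Lop A w x
      + τ * ((∑ i, (-2 * N) * ((-2 * (N + 1) * (P * e ^ 2) * z i) * Y i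
          + P * e * (A i i x + ∑ j, da i i j * z j))) - wh N A x0 r x) * v x := by
  have hP' : P = wE x0 r x ^ N := by rw [hP, he]
  have hexp : ∀ y, HP (fun y => Real.exp (τ * wE x0 r y ^ N)) y
      (fun i => Real.exp (τ * wE x0 r y ^ N) *
        (τ * (-2 * N * (wE x0 r y ^ N * wE x0 r y) * (y i - x0 i)))) := fun y =>
    ((HP_wP x0 hr y N).const_mul τ).comp (Real.hasDerivAt_exp _)
  have hev : ∀ᶠ y in nhds x, ContDiffAt ℝ 2 w y := hw.eventually (by simp)
  have hpd : ∀ y, ContDiffAt ℝ 2 w y → ∀ j, pd j v y = Real.exp (τ * wE x0 r y ^ N) *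
      (pd j w y + τ * ((-2 * N) * ((wE x0 r y ^ N * wE x0 r y) * (y j - x0 j))) * w y) := by
    intro y hy j
    have h1 : HP w y (fun i => pd i w y) := HP.of_diff (hy.differentiableAt (by norm_num))
    rw [hv, ((hexp y).mul h1).2 j]; ring
  have hg : ∀ j, pd j v x = Real.exp (τ * P) * (pd j w x + τ * (-2 * N * (P * e) * z j) * w x) := by
    intro j
    rw [hpd x hw j, hP', he, hz]; ring
  refine ⟨hg, ?_⟩
  have hw1 : HP w x (fun i => pd i w x) := HP.of_diff (hw.differentiableAt (by norm_num))
  have hDv : ∀ j, HP (pd j v) x (fun i => (Real.exp (τ * P) * τ * (-2 * N * (P * e) * z i)) *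
        (pd j w x + τ * (-2 * N * (P * e) * z j) * w x)
      + Real.exp (τ * P) * (pd i (pd j w) x + τ * (((-2 * N) * ((-2 * (N + 1) * (P * e ^ 2) * z i)
        * z j + P * e * (if j = i then 1 else 0))) * w x + (-2 * N * (P * e) * z j) * pd i w x))) := by
    intro j
    have h2 := (hexp x).mul ((pd_hp hw j).add
      (((((HP_wPE x0 hr x N).mul (HP.coord x0 j)).const_mul (-2 * N)).const_mul τ).mul hw1))
    refine (h2.congr_f (hev.mono fun y hy => hpd y hy j)).congr_d fun i => ?_
    rw [hP', he, hz]; ring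
  have hLv : Lop A v x = ∑ i, ∑ j, (da i i j * pd j v x + A i j x * pd i (pd j v) x) := by
    unfold Lop
    refine Finset.sum_congr rfl fun i _ => Finset.sum_congr rfl fun j _ => ?_
    rw [((hA i j).mul (hDv j)).2 i, (hDv j).2 i]
  have hLw : Lop A w x = ∑ i, ∑ j, (da i i j * pd j w x + A i j x * pd i (pd j w) x) := by
    unfold Lop
    refine Finset.sum_congr rfl fun i _ => Finset.sum_congr rfl fun j _ => ?_
    rw [((hA i j).mul (pd_hp hw j)).2 i]
  have key := conj_alg hn τ (Real.exp (τ * P)) (w x) (fun i j => A i j x) da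
    (fun j => pd j v x) (fun j => pd j w x) (fun j => -2 * N * (P * e) * z j)
    (fun i j => pd i (pd j v) x) (fun i j => pd i (pd j w) x)
    (fun i j => (-2 * N) * ((-2 * (N + 1) * (P * e ^ 2) * z i)
        * z j + P * e * (if j = i then 1 else 0))) ha hg (fun i j => (hDv j).2 i)
  have hvx : v x = Real.exp (τ * P) * w x := by rw [hv, hP']
  have hX : ∀ k, wX N A x0 r k x = ∑ j, A k j x * (-2 * N * (P * e) * z j) := by
    intro k
    unfold wX wY
    rw [hP', he, hz, Finset.mul_sum, Finset.mul_sum]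
    exact Finset.sum_congr rfl fun j _ => by ring
  have hp : wp N A x0 r x
      = ∑ i, (-2 * N * (P * e) * z i) * (∑ j, A i j x * (-2 * N * (P * e) * z j)) := by
    simp only [← hX]
    unfold wp wQ wX
    rw [hP', he, hz, Finset.mul_sum, Finset.mul_sum]
    exact Finset.sum_congr rfl fun j _ => by ring
  have hdiv : (∑ i, (-2 * N) * ((-2 * (N + 1) * (P * e ^ 2) * z i) * Y i
          + P * e * (A i i x + ∑ j, da i i j * z j)))
      = ∑ i, ∑ j, (da i i j * (-2 * N * (P * e) * z j) + A i j x *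
        ((-2 * N) * ((-2 * (N + 1) * (P * e ^ 2) * z i)
        * z j + P * e * (if j = i then 1 else 0)))) := by
    refine Finset.sum_congr rfl fun i _ => ?_
    have e1 : Y i = ∑ j, A i j x * z j := by rw [hYd, hz]; rfl
    have e2 : A i i x = ∑ j, A i j x * (if j = i then 1 else 0) := by simp
    rw [e1, e2]
    rw [← Finset.sum_add_distrib, Finset.mul_sum, Finset.mul_sum, ← Finset.sum_add_distrib,
      Finset.mul_sum]
    exact Finset.sum_congr rfl fun j _ => by ring
  rw [hLv, hLw, hvx, hdiv, hp]
  simp only [hX]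
  linear_combination key


/-! ### Scalar estimates -/

lemma cross_bound (k δ v y : ℝ) (hδ : 0 < δ) (hy : y ^ 2 ≤ k) : -(δ + k * v ^ 2 / (4 * δ)) ≤ v * y := by
  have h1 : 0 ≤ (2 * δ + v * y) ^ 2 := sq_nonneg _
  have h2 : v ^ 2 * y ^ 2 ≤ v ^ 2 * k := mul_le_mul_of_nonneg_left hy (sq_nonneg v)
  have h3 : -(v * y) * (4 * δ) ≤ 4 * δ * δ + k * v ^ 2 := by nlinarith
  have h4 : -(v * y) ≤ (4 * δ * δ + k * v ^ 2) / (4 * δ) := by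
    rw [le_div_iff₀ (by positivity)]; exact h3
  have h5 : (4 * δ * δ + k * v ^ 2) / (4 * δ) = δ + k * v ^ 2 / (4 * δ) := by
    field_simp
  linarith

lemma cross_sq {ν P e C s G Q W Z2 : ℝ} (hs : 0 ≤ s) (hG : 0 ≤ G) (he : 1 ≤ e) (hes : e * s ≤ 1)
    (hQ2 : Q ^ 2 ≤ C ^ 2 * s ^ 2) (hW : W ^ 2 ≤ C ^ 2 * (s * G)) (hZ2 : Z2 ^ 2 ≤ C ^ 2 * (s * G)) :
    (-16 * ν ^ 2 * (ν + 2) * P * e ^ 3 * Q * W + 8 * ν ^ 2 * P * e ^ 2 * Z2) ^ 2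
      ≤ (2 * (256 * ν ^ 4 * (ν + 2) ^ 2 * C ^ 4 + 64 * ν ^ 4 * C ^ 2)) * (P ^ 2 * e ^ 3 * G) := by
  have hes0 : 0 ≤ e * s := by positivity
  have h1 : e ^ 6 * (Q ^ 2 * W ^ 2) ≤ C ^ 4 * (e ^ 3 * G) := by
    have a1 : Q ^ 2 * W ^ 2 ≤ (C ^ 2 * s ^ 2) * (C ^ 2 * (s * G)) :=
      mul_le_mul hQ2 hW (sq_nonneg _) (by positivity)
    have a2 : (e * s) ^ 3 ≤ 1 := pow_le_one₀ hes0 hes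
    calc e ^ 6 * (Q ^ 2 * W ^ 2) ≤ e ^ 6 * ((C ^ 2 * s ^ 2) * (C ^ 2 * (s * G))) := by gcongr
      _ = (C ^ 4 * (e ^ 3 * G)) * (e * s) ^ 3 := by ring
      _ ≤ (C ^ 4 * (e ^ 3 * G)) * 1 := by gcongr
      _ = _ := by ring
  have h2 : e ^ 4 * Z2 ^ 2 ≤ C ^ 2 * (e ^ 3 * G) := by
    calc e ^ 4 * Z2 ^ 2 ≤ e ^ 4 * (C ^ 2 * (s * G)) := by gcongr
      _ = (C ^ 2 * (e ^ 3 * G)) * (e * s) := by ring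
      _ ≤ (C ^ 2 * (e ^ 3 * G)) * 1 := by gcongr
      _ = _ := by ring
  have h3 : ∀ a b : ℝ, (a + b) ^ 2 ≤ 2 * (a ^ 2 + b ^ 2) := fun a b => by nlinarith [sq_nonneg (a - b)]
  refine (h3 _ _).trans ?_
  have h4 : 256 * ν ^ 4 * (ν + 2) ^ 2 * P ^ 2 * (e ^ 6 * (Q ^ 2 * W ^ 2))
      ≤ 256 * ν ^ 4 * (ν + 2) ^ 2 * P ^ 2 * (C ^ 4 * (e ^ 3 * G)) := by gcongr
  have h5 : 64 * ν ^ 4 * P ^ 2 * (e ^ 4 * Z2 ^ 2) ≤ 64 * ν ^ 4 * P ^ 2 * (C ^ 2 * (e ^ 3 * G)) := by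
    gcongr
  nlinarith

set_option maxHeartbeats 1000000 in
lemma quad_lower {ν P e lam C s G Q W q Z1 Z2 Z3 v σ K : ℝ} (hlam : 0 < lam) (hC : 0 < C)
    (hs : 0 ≤ s) (hG : 0 ≤ G) (hP : 1 ≤ P) (he : 1 ≤ e) (hes : e * s ≤ 1) (hes2 : 1 / 2 ≤ e * s)
    (hQ : lam * s ≤ Q) (hQ2 : Q ^ 2 ≤ C ^ 2 * s ^ 2) (hW : W ^ 2 ≤ C ^ 2 * (s * G))
    (hq : lam * G ≤ q) (hZ1 : |Z1| ≤ C * G) (hZ2 : Z2 ^ 2 ≤ C ^ 2 * (s * G))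
    (hZ3 : |Z3| ≤ C * s) (hν : 2 ≤ ν) (hν2 : 4 * C ≤ ν * lam ^ 2)
    (hK : K = 2 * (256 * ν ^ 4 * (ν + 2) ^ 2 * C ^ 4 + 64 * ν ^ 4 * C ^ 2))
    (hσ : K ≤ ν ^ 6 * lam ^ 4 * σ) (hσ1 : 1 ≤ σ) :
    1 / 4 * ν ^ 2 * lam ^ 2 * (P * e * G) + ν ^ 4 * lam ^ 2 * (σ * (P ^ 3 * e ^ 2) * v ^ 2) ≤
      8 * ν * (ν + 1) * P * e ^ 2 * W ^ 2 + 4 * ν * (ν - 1) * P * e ^ 2 * Q * q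
      + 2 * ν * P * e * Z1
      + v * (-16 * ν ^ 2 * (ν + 2) * P * e ^ 3 * Q * W + 8 * ν ^ 2 * P * e ^ 2 * Z2)
      + σ * v ^ 2 * ((16 * ν ^ 4 + 48 * ν ^ 3) * P ^ 3 * e ^ 4 * Q ^ 2
          - 8 * ν ^ 3 * P ^ 3 * e ^ 3 * Z3) := by
  have hQ0 : 0 ≤ Q := le_trans (by positivity) hQ
  have heQ : lam / 2 ≤ e * Q := by nlinarith
  have t1 : 0 ≤ 8 * ν * (ν + 1) * P * e ^ 2 * W ^ 2 := by positivity
  have t2 : ν ^ 2 * lam ^ 2 * (P * e * G) ≤ 4 * ν * (ν - 1) * P * e ^ 2 * Q * q := by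
    have a1 : lam / 2 * (lam * G) ≤ e * Q * q := mul_le_mul heQ hq (by positivity) (by positivity)
    have a2 : 2 * ν ^ 2 ≤ 4 * ν * (ν - 1) := by nlinarith
    have a3 : 0 ≤ 4 * ν * (ν - 1) := le_trans (by positivity) a2
    calc ν ^ 2 * lam ^ 2 * (P * e * G) = (2 * ν ^ 2) * (P * e * (lam / 2 * (lam * G))) := by ring
      _ ≤ (4 * ν * (ν - 1)) * (P * e * (e * Q * q)) := by gcongr
      _ = _ := by ring
  have t3 : -(1 / 2 * ν ^ 2 * lam ^ 2 * (P * e * G)) ≤ 2 * ν * P * e * Z1 := by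
    have a1 : -(C * G) ≤ Z1 := (abs_le.mp hZ1).1
    have a2 : 2 * ν * P * e * (-(C * G)) ≤ 2 * ν * P * e * Z1 := by gcongr
    have a3 : (4 * C) * (ν * (P * e * G)) ≤ (ν * lam ^ 2) * (ν * (P * e * G)) := by gcongr
    linarith
  have hK0 : 0 ≤ K := by rw [hK]; positivity
  have t4 : -(1 / 4 * ν ^ 2 * lam ^ 2 * (P * e * G) + ν ^ 4 * lam ^ 2 * (σ * (P ^ 3 * e ^ 2) * v ^ 2))
      ≤ v * (-16 * ν ^ 2 * (ν + 2) * P * e ^ 3 * Q * W + 8 * ν ^ 2 * P * e ^ 2 * Z2) := by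
    have a0 := cross_sq (ν := ν) (P := P) hs hG he hes hQ2 hW hZ2
    rw [← hK] at a0
    rcases hG.eq_or_lt with h0 | hGpos
    · rw [← h0] at a0 ⊢
      have : (-16 * ν ^ 2 * (ν + 2) * P * e ^ 3 * Q * W + 8 * ν ^ 2 * P * e ^ 2 * Z2) = 0 := by
        have h9 : (-16 * ν ^ 2 * (ν + 2) * P * e ^ 3 * Q * W + 8 * ν ^ 2 * P * e ^ 2 * Z2) ^ 2 ≤ 0 := by
          simpa using a0
        exact pow_eq_zero_iff (two_ne_zero) |>.mp (le_antisymm h9 (sq_nonneg _))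
      rw [this]
      have : 0 ≤ ν ^ 4 * lam ^ 2 * (σ * (P ^ 3 * e ^ 2) * v ^ 2) := by positivity
      linarith
    · have a1 := cross_bound _ (1 / 4 * ν ^ 2 * lam ^ 2 * (P * e * G)) v _ (by positivity) a0
      refine le_trans ?_ a1
      have a2 : K * (P ^ 2 * e ^ 3 * G) * v ^ 2 / (4 * (1 / 4 * ν ^ 2 * lam ^ 2 * (P * e * G)))
          = K / (ν ^ 2 * lam ^ 2) * (P * e ^ 2 * v ^ 2) := by
        field_simp
      rw [a2]
      have a3 : K / (ν ^ 2 * lam ^ 2) ≤ ν ^ 4 * lam ^ 2 * σ := by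
        rw [div_le_iff₀ (by positivity)]
        calc K ≤ _ := hσ
          _ = _ := by ring
      have a4 : P ≤ P ^ 3 := le_self_pow₀ hP (by norm_num)
      have a5 : K / (ν ^ 2 * lam ^ 2) * (P * e ^ 2 * v ^ 2)
          ≤ ν ^ 4 * lam ^ 2 * σ * (P ^ 3 * e ^ 2 * v ^ 2) := by gcongr
      linarith
  have t5 : 2 * (ν ^ 4 * lam ^ 2 * (σ * (P ^ 3 * e ^ 2) * v ^ 2)) ≤
      σ * v ^ 2 * ((16 * ν ^ 4 + 48 * ν ^ 3) * P ^ 3 * e ^ 4 * Q ^ 2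
          - 8 * ν ^ 3 * P ^ 3 * e ^ 3 * Z3) := by
    have a1 : (lam / 2) ^ 2 ≤ (e * Q) ^ 2 := by gcongr
    have a2 : e * Z3 ≤ C := by
      have : Z3 ≤ C * s := (abs_le.mp hZ3).2
      calc e * Z3 ≤ e * (C * s) := by gcongr
        _ = C * (e * s) := by ring
        _ ≤ C * 1 := by gcongr
        _ = C := by ring
    have a3 : 2 * ν ^ 4 * lam ^ 2 ≤ (16 * ν ^ 4 + 48 * ν ^ 3) * (e * Q) ^ 2 - 8 * ν ^ 3 * (e * Z3) := by
      have b1 : 16 * ν ^ 4 * (lam / 2) ^ 2 ≤ 16 * ν ^ 4 * (e * Q) ^ 2 := by gcongr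
      have b2 : 0 ≤ 48 * ν ^ 3 * (e * Q) ^ 2 := by positivity
      have b3 : 8 * ν ^ 3 * (e * Z3) ≤ 8 * ν ^ 3 * C := by gcongr
      have b4 : 2 * ν ^ 3 * (4 * C) ≤ 2 * ν ^ 3 * (ν * lam ^ 2) := by gcongr
      linarith
    calc 2 * (ν ^ 4 * lam ^ 2 * (σ * (P ^ 3 * e ^ 2) * v ^ 2))
        = (σ * v ^ 2 * (P ^ 3 * e ^ 2)) * (2 * ν ^ 4 * lam ^ 2) := by ring
      _ ≤ (σ * v ^ 2 * (P ^ 3 * e ^ 2)) *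
          ((16 * ν ^ 4 + 48 * ν ^ 3) * (e * Q) ^ 2 - 8 * ν ^ 3 * (e * Z3)) := by gcongr
      _ = _ := by ring
  linarith

set_option maxHeartbeats 1000000 in
lemma quad_crude {ν P e C s G Q W q Z1 Z2 Z3 v σ K : ℝ} (hC : 0 < C)
    (hs : 0 ≤ s) (hG : 0 ≤ G) (hP : 1 ≤ P) (he : 1 ≤ e) (hes : e * s ≤ 1)
    (hQ : 0 ≤ Q) (hQ2 : Q ^ 2 ≤ C ^ 2 * s ^ 2) (hW : W ^ 2 ≤ C ^ 2 * (s * G))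
    (hq : 0 ≤ q) (hZ1 : |Z1| ≤ C * G) (hZ2 : Z2 ^ 2 ≤ C ^ 2 * (s * G))
    (hZ3 : |Z3| ≤ C * s) (hν : 2 ≤ ν)
    (hK : K = 2 * (256 * ν ^ 4 * (ν + 2) ^ 2 * C ^ 4 + 64 * ν ^ 4 * C ^ 2)) (hσ1 : 1 ≤ σ) :
    -((2 * ν * C + 1 + K + 8 * ν ^ 3 * C) * (P * e * G + σ * (P ^ 3 * e ^ 2) * v ^ 2)) ≤
      8 * ν * (ν + 1) * P * e ^ 2 * W ^ 2 + 4 * ν * (ν - 1) * P * e ^ 2 * Q * q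
      + 2 * ν * P * e * Z1
      + v * (-16 * ν ^ 2 * (ν + 2) * P * e ^ 3 * Q * W + 8 * ν ^ 2 * P * e ^ 2 * Z2)
      + σ * v ^ 2 * ((16 * ν ^ 4 + 48 * ν ^ 3) * P ^ 3 * e ^ 4 * Q ^ 2
          - 8 * ν ^ 3 * P ^ 3 * e ^ 3 * Z3) := by
  have t1 : 0 ≤ 8 * ν * (ν + 1) * P * e ^ 2 * W ^ 2 := by positivity
  have t2 : 0 ≤ 4 * ν * (ν - 1) * P * e ^ 2 * Q * q := by
    have : 0 ≤ ν - 1 := by linarith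
    positivity
  have t3 : -(2 * ν * C * (P * e * G)) ≤ 2 * ν * P * e * Z1 := by
    have a1 : -(C * G) ≤ Z1 := (abs_le.mp hZ1).1
    have a2 : 2 * ν * P * e * (-(C * G)) ≤ 2 * ν * P * e * Z1 := by gcongr
    linarith
  have hK0 : 0 ≤ K := by rw [hK]; positivity
  have t4 : -(P * e * G + K * (σ * (P ^ 3 * e ^ 2) * v ^ 2))
      ≤ v * (-16 * ν ^ 2 * (ν + 2) * P * e ^ 3 * Q * W + 8 * ν ^ 2 * P * e ^ 2 * Z2) := by
    have a0 := cross_sq (ν := ν) (P := P) hs hG he hes hQ2 hW hZ2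
    rw [← hK] at a0
    set S := (-16 * ν ^ 2 * (ν + 2) * P * e ^ 3 * Q * W + 8 * ν ^ 2 * P * e ^ 2 * Z2) with hS
    have b1 : (v * S) ^ 2 ≤ (P * e * G + K * (P * e ^ 2 * v ^ 2)) ^ 2 := by
      have c1 : (v * S) ^ 2 ≤ v ^ 2 * (K * (P ^ 2 * e ^ 3 * G)) := by
        rw [mul_pow]; gcongr
      have c2 : v ^ 2 * (K * (P ^ 2 * e ^ 3 * G)) = (P * e * G) * (K * (P * e ^ 2 * v ^ 2)) := by ring
      have c3 : 0 ≤ P * e * G := by positivity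
      have c4 : 0 ≤ K * (P * e ^ 2 * v ^ 2) := by positivity
      nlinarith
    have b2 := abs_le_of_sq_le_sq b1 (by positivity)
    have a4 : P ≤ P ^ 3 := le_self_pow₀ hP (by norm_num)
    have a5 : 1 * (P * e ^ 2) * v ^ 2 ≤ σ * (P ^ 3 * e ^ 2) * v ^ 2 := by gcongr
    have a6 : K * (1 * (P * e ^ 2) * v ^ 2) ≤ K * (σ * (P ^ 3 * e ^ 2) * v ^ 2) := by gcongr
    have b3 := (abs_le.mp b2).1
    linarith
  have t5 : -(8 * ν ^ 3 * C * (σ * (P ^ 3 * e ^ 2) * v ^ 2)) ≤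
      σ * v ^ 2 * ((16 * ν ^ 4 + 48 * ν ^ 3) * P ^ 3 * e ^ 4 * Q ^ 2
          - 8 * ν ^ 3 * P ^ 3 * e ^ 3 * Z3) := by
    have a2 : e * Z3 ≤ C := by
      have : Z3 ≤ C * s := (abs_le.mp hZ3).2
      calc e * Z3 ≤ e * (C * s) := by gcongr
        _ = C * (e * s) := by ring
        _ ≤ C * 1 := by gcongr
        _ = C := by ring
    have b2 : 0 ≤ (σ * v ^ 2) * ((16 * ν ^ 4 + 48 * ν ^ 3) * P ^ 3 * e ^ 4 * Q ^ 2) := by positivity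
    have b3 : (σ * v ^ 2 * (8 * ν ^ 3 * (P ^ 3 * e ^ 2))) * (e * Z3)
        ≤ (σ * v ^ 2 * (8 * ν ^ 3 * (P ^ 3 * e ^ 2))) * C := by gcongr
    linarith
  have u1 : 0 ≤ P * e * G := by positivity
  have u2 : 0 ≤ σ * (P ^ 3 * e ^ 2) * v ^ 2 := by positivity
  have u3 : 0 ≤ (K + 8 * ν ^ 3 * C) * (P * e * G) := by positivity
  have u4 : 0 ≤ (2 * ν * C + 1) * (σ * (P ^ 3 * e ^ 2) * v ^ 2) := by positivity
  linarith


lemma sum_le3 {n : ℕ} (hn : n = 2 ∨ n = 3) (f : Fin n → ℝ) (c : ℝ) (h : ∀ i, |f i| ≤ c) :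
    |∑ i, f i| ≤ 3 * c := by
  have hc : 0 ≤ c := by
    rcases hn with rfl | rfl
    · exact (abs_nonneg _).trans (h 0)
    · exact (abs_nonneg _).trans (h 0)
  refine (Finset.abs_sum_le_sum_abs _ _).trans ((Finset.sum_le_sum fun i _ => h i).trans ?_)
  rcases hn with rfl | rfl <;> simp <;> linarith

lemma abs_mul_le' {a b c d : ℝ} (h1 : |a| ≤ c) (h2 : |b| ≤ d) : |a * b| ≤ c * d := by
  rw [abs_mul]
  exact mul_le_mul h1 h2 (abs_nonneg _) ((abs_nonneg _).trans h1)

lemma abs_le_sqrt_sum {n : ℕ} (z : Fin n → ℝ) (i : Fin n) : |z i| ≤ √(∑ k, z k ^ 2) := by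
  refine Real.abs_le_sqrt ?_
  exact Finset.single_le_sum (f := fun k => z k ^ 2) (fun k _ => sq_nonneg _) (Finset.mem_univ i)

lemma data_bounds {n : ℕ} (hn : n = 2 ∨ n = 3) {B s G : ℝ} (hB : 1 ≤ B) (a : Fin n → Fin n → ℝ)
    (da : Fin n → Fin n → Fin n → ℝ) (z g Y F dQ : Fin n → ℝ) (dY : Fin n → Fin n → ℝ)
    (ha : ∀ i j, |a i j| ≤ B) (hda : ∀ k i j, |da k i j| ≤ B)
    (hs : s = ∑ i, z i ^ 2) (hG : G = ∑ i, g i ^ 2) (hs1 : s ≤ 1)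
    (hY : ∀ k, Y k = ∑ j, a k j * z j) (hF : ∀ k, F k = ∑ j, a k j * g j)
    (hdY : ∀ i k, dY i k = a k i + ∑ j, da i k j * z j)
    (hdQ : ∀ i, dQ i = Y i + ∑ k, z k * dY i k) :
    (∑ k, z k * Y k) ^ 2 ≤ (500 * B ^ 2) ^ 2 * s ^ 2 ∧
    (∑ k, Y k * g k) ^ 2 ≤ (500 * B ^ 2) ^ 2 * (s * G) ∧
    |-2 * (∑ i, ∑ k, F i * dY i k * g k) + (∑ i, dY i i) * (∑ k, g k * F k)
          + ∑ k, ∑ i, ∑ j, Y k * da k i j * g i * g j| ≤ (500 * B ^ 2) * G ∧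
    (∑ i, F i * dQ i) ^ 2 ≤ (500 * B ^ 2) ^ 2 * (s * G) ∧
    |(∑ i, Y i * dQ i) + (∑ k, z k * Y k) * (∑ i, dY i i)| ≤ (500 * B ^ 2) * s ∧
    |∑ i, dY i i| ≤ 500 * B ^ 2 := by
  have hs0 : 0 ≤ s := hs ▸ Finset.sum_nonneg fun i _ => sq_nonneg _
  have hG0 : 0 ≤ G := hG ▸ Finset.sum_nonneg fun i _ => sq_nonneg _
  obtain ⟨Z, hZ⟩ : ∃ Z, Z = √s := ⟨_, rfl⟩
  obtain ⟨T, hT⟩ : ∃ T, T = √G := ⟨_, rfl⟩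
  have hZ0 : 0 ≤ Z := hZ ▸ Real.sqrt_nonneg _
  have hT0 : 0 ≤ T := hT ▸ Real.sqrt_nonneg _
  have hZs : Z ^ 2 = s := by rw [hZ, Real.sq_sqrt hs0]
  have hTG : T ^ 2 = G := by rw [hT, Real.sq_sqrt hG0]
  have hZ1 : Z ≤ 1 := by nlinarith
  have hz : ∀ i, |z i| ≤ Z := fun i => by rw [hZ, hs]; exact abs_le_sqrt_sum z i
  have hg : ∀ i, |g i| ≤ T := fun i => by rw [hT, hG]; exact abs_le_sqrt_sum g i
  have bY : ∀ k, |Y k| ≤ 3 * (B * Z) := fun k => by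
    rw [hY]; exact sum_le3 hn _ _ fun j => abs_mul_le' (ha k j) (hz j)
  have bF : ∀ k, |F k| ≤ 3 * (B * T) := fun k => by
    rw [hF]; exact sum_le3 hn _ _ fun j => abs_mul_le' (ha k j) (hg j)
  have bdY : ∀ i k, |dY i k| ≤ 4 * B := fun i k => by
    rw [hdY]
    have h1 : |∑ j, da i k j * z j| ≤ 3 * (B * Z) :=
      sum_le3 hn _ _ fun j => abs_mul_le' (hda i k j) (hz j)
    have h2 : B * Z ≤ B * 1 := by gcongr
    have := abs_add_le (a k i) (∑ j, da i k j * z j)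
    linarith [ha k i]
  have bdQ : ∀ i, |dQ i| ≤ 15 * (B * Z) := fun i => by
    rw [hdQ]
    have h1 : |∑ k, z k * dY i k| ≤ 3 * (Z * (4 * B)) :=
      sum_le3 hn _ _ fun j => abs_mul_le' (hz j) (bdY i j)
    have := abs_add_le (Y i) (∑ k, z k * dY i k)
    linarith [bY i]
  have bQ : |∑ k, z k * Y k| ≤ 3 * (Z * (3 * (B * Z))) :=
    sum_le3 hn _ _ fun j => abs_mul_le' (hz j) (bY j)
  have bW : |∑ k, Y k * g k| ≤ 3 * (3 * (B * Z) * T) :=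
    sum_le3 hn _ _ fun j => abs_mul_le' (bY j) (hg j)
  have bq : |∑ k, g k * F k| ≤ 3 * (T * (3 * (B * T))) :=
    sum_le3 hn _ _ fun j => abs_mul_le' (hg j) (bF j)
  have by' : |∑ i, dY i i| ≤ 3 * (4 * B) := sum_le3 hn _ _ fun j => bdY j j
  have b1 : |∑ i, ∑ k, F i * dY i k * g k| ≤ 3 * (3 * (3 * (B * T) * (4 * B) * T)) :=
    sum_le3 hn _ _ fun i => sum_le3 hn _ _ fun k =>
      abs_mul_le' (abs_mul_le' (bF i) (bdY i k)) (hg k)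
  have b2 : |∑ k, ∑ i, ∑ j, Y k * da k i j * g i * g j| ≤
      3 * (3 * (3 * (3 * (B * Z) * B * T * T))) :=
    sum_le3 hn _ _ fun k => sum_le3 hn _ _ fun i => sum_le3 hn _ _ fun j =>
      abs_mul_le' (abs_mul_le' (abs_mul_le' (bY k) (hda k i j)) (hg i)) (hg j)
  have b3 : |∑ i, F i * dQ i| ≤ 3 * (3 * (B * T) * (15 * (B * Z))) :=
    sum_le3 hn _ _ fun j => abs_mul_le' (bF j) (bdQ j)
  have b4 : |∑ i, Y i * dQ i| ≤ 3 * (3 * (B * Z) * (15 * (B * Z))) :=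
    sum_le3 hn _ _ fun j => abs_mul_le' (bY j) (bdQ j)
  have hBB : B ≤ B ^ 2 := by nlinarith
  have hB2 : 0 ≤ B ^ 2 := sq_nonneg B
  refine ⟨?_, ?_, ?_, ?_, ?_, ?_⟩
  · rw [← mul_pow, ← hZs]
    refine sq_le_sq' ?_ ?_
    all_goals
      have h1 : B * Z ^ 2 ≤ B ^ 2 * Z ^ 2 := by gcongr
      have h2 : 0 ≤ B ^ 2 * Z ^ 2 := by positivity
      have := abs_le.mp bQ
      linarith [this.1, this.2]
  · rw [← hZs, ← hTG, ← mul_pow, ← mul_pow]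
    refine sq_le_sq' ?_ ?_
    all_goals
      have h1 : B * (Z * T) ≤ B ^ 2 * (Z * T) := by gcongr
      have h2 : 0 ≤ B ^ 2 * (Z * T) := by positivity
      have := abs_le.mp bW
      linarith [this.1, this.2]
  · have c1 := abs_mul_le' by' bq
    have c2 : B ^ 2 * T ^ 2 * Z ≤ B ^ 2 * T ^ 2 * 1 := by gcongr
    have c3 : 0 ≤ B ^ 2 * T ^ 2 := by positivity
    rw [← hTG]
    have d1 := abs_le.mp b1
    have d2 := abs_le.mp b2
    have d3 := abs_le.mp c1
    rw [abs_le]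
    constructor <;> linarith [d1.1, d1.2, d2.1, d2.2, d3.1, d3.2]
  · rw [← hZs, ← hTG, ← mul_pow, ← mul_pow]
    refine sq_le_sq' ?_ ?_
    all_goals
      have h2 : 0 ≤ B ^ 2 * (Z * T) := by positivity
      have := abs_le.mp b3
      linarith [this.1, this.2]
  · have c1 := abs_mul_le' bQ by'
    have c3 : 0 ≤ B ^ 2 * Z ^ 2 := by positivity
    rw [← hZs]
    have d1 := abs_le.mp b4
    have d3 := abs_le.mp c1
    rw [abs_le]
    constructor <;> linarith [d1.1, d1.2, d3.1, d3.2]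
  · linarith


set_option maxHeartbeats 2000000 in
lemma pt_scalar {Kp : Prop} {ν P e C s G H2 K2 K3 c1 lam v w E Lw dv Qd S T R τ : ℝ}
    (hlam : 0 < lam) (hC : 0 < C) (hν : 2 ≤ ν) (hP : 1 ≤ P) (he : 1 ≤ e)
    (hs : 0 ≤ s) (hG : 0 ≤ G) (hes : e * s ≤ 1) (hτ : 1 ≤ τ)
    (hH : 0 ≤ H2) (hE : 0 < E) (hv : v = E * w)
    (hST : dv + Qd = S * T) (hconj : S + τ * T = E * Lw + τ * R * v) (hR : |R| ≤ K3 * (P * e))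
    (hK2 : 0 ≤ K2)
    (hτ3 : K3 ^ 2 ≤ ν ^ 4 * lam ^ 2 * τ) (hc1 : c1 = 1 / 4 * ν ^ 2 * lam ^ 2)
    (hlow : Kp → c1 * (P * e * G) + ν ^ 4 * lam ^ 2 * (τ ^ 2 * (P ^ 3 * e ^ 2) * v ^ 2) ≤ Qd)
    (hcr : -(K2 * (P * e * G + τ ^ 2 * (P ^ 3 * e ^ 2) * v ^ 2)) ≤ Qd)
    (hGw : G ≤ 2 * E ^ 2 * H2 + 2 * τ ^ 2 * (4 * ν ^ 2 * P ^ 2 * e ^ 2 * s) * v ^ 2)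
    (hwG : E ^ 2 * H2 ≤ 2 * G + 2 * τ ^ 2 * (4 * ν ^ 2 * P ^ 2 * e ^ 2 * s) * v ^ 2) :
    (Kp → c1 / (10 * ν ^ 2 + 1) * (E ^ 2 * (w ^ 2 + H2) + τ * (E ^ 2 * w ^ 2)) ≤
      1 / 2 * E ^ 2 * Lw ^ 2 - τ * dv) ∧
    -(((K2 + K3 ^ 2) * (3 + 8 * ν ^ 2)) * (τ ^ 3 * (P ^ 3 * e ^ 2)) * (E ^ 2 * (w ^ 2 + H2))) ≤
      1 / 2 * E ^ 2 * Lw ^ 2 - τ * dv := by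
  have hc10 : 0 < c1 := by rw [hc1]; positivity
  have hmain : τ * Qd ≤ 1 / 2 * E ^ 2 * Lw ^ 2 + 1 / 2 * τ ^ 2 * (K3 ^ 2 * (P ^ 2 * e ^ 2)) * v ^ 2
      - τ * dv := by
    have h1 : τ * (S * T) ≤ 1 / 4 * (S + τ * T) ^ 2 := by nlinarith [sq_nonneg (S - τ * T)]
    have h2 : (E * Lw + τ * R * v) ^ 2 ≤ 2 * (E * Lw) ^ 2 + 2 * (τ * R * v) ^ 2 := by
      nlinarith [sq_nonneg (E * Lw - τ * R * v)]
    have h3 : R ^ 2 ≤ (K3 * (P * e)) ^ 2 := sq_le_sq' (abs_le.mp hR).1 (abs_le.mp hR).2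
    have h4 : τ ^ 2 * v ^ 2 * R ^ 2 ≤ τ ^ 2 * v ^ 2 * (K3 * (P * e)) ^ 2 := by gcongr
    rw [hconj] at h1
    have h5 : τ * (dv + Qd) = τ * (S * T) := by rw [hST]
    linarith
  obtain ⟨X1, hX1⟩ : ∃ X1, X1 = τ * (P * e * G) := ⟨_, rfl⟩
  obtain ⟨X2, hX2⟩ : ∃ X2, X2 = τ ^ 3 * (P ^ 3 * e ^ 2) * v ^ 2 := ⟨_, rfl⟩
  have hX10 : 0 ≤ X1 := by rw [hX1]; positivity
  have hX20 : 0 ≤ X2 := by rw [hX2]; positivity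
  have hP23 : P ^ 2 ≤ P ^ 3 := pow_le_pow_right₀ hP (by norm_num)
  have hτ23 : τ ^ 2 ≤ τ ^ 3 := pow_le_pow_right₀ hτ (by norm_num)
  have hee : e ≤ e ^ 2 := le_self_pow₀ he (by norm_num)
  have hGX : G ≤ X1 := by
    rw [hX1]
    calc G = 1 * (1 * 1 * G) := by ring
      _ ≤ τ * (P * e * G) := by gcongr
  have hτv : τ * v ^ 2 ≤ X2 := by
    rw [hX2]
    have : τ ≤ τ ^ 3 := le_self_pow₀ hτ (by norm_num)
    have h1 : 1 ≤ P ^ 3 := one_le_pow₀ hP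
    have h2 : 1 ≤ e ^ 2 := one_le_pow₀ he
    calc τ * v ^ 2 = τ * (1 * 1) * v ^ 2 := by ring
      _ ≤ _ := by gcongr
  have hv2 : v ^ 2 ≤ X2 := by
    refine le_trans ?_ hτv
    exact le_mul_of_one_le_left (sq_nonneg v) hτ
  have hfv : 2 * τ ^ 2 * (4 * ν ^ 2 * P ^ 2 * e ^ 2 * s) * v ^ 2 ≤ 8 * ν ^ 2 * X2 := by
    have h1 : e ^ 2 * s ≤ e := by
      have := mul_le_mul_of_nonneg_left hes (by linarith : (0:ℝ) ≤ e)
      linarith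
    calc 2 * τ ^ 2 * (4 * ν ^ 2 * P ^ 2 * e ^ 2 * s) * v ^ 2
        = 8 * ν ^ 2 * (τ ^ 2 * (P ^ 2 * (e ^ 2 * s)) * v ^ 2) := by ring
      _ ≤ 8 * ν ^ 2 * (τ ^ 3 * (P ^ 3 * (e ^ 2)) * v ^ 2) := by
        have := h1.trans hee
        gcongr
      _ = _ := by rw [hX2]
  have hEw : E ^ 2 * w ^ 2 = v ^ 2 := by rw [hv]; ring
  have hν2 : 4 ≤ ν ^ 2 := by nlinarith
  have hkv : 1 / 2 * τ ^ 2 * (K3 ^ 2 * (P ^ 2 * e ^ 2)) * v ^ 2 ≤ 1 / 2 * (ν ^ 4 * lam ^ 2) * X2 := by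
    calc 1 / 2 * τ ^ 2 * (K3 ^ 2 * (P ^ 2 * e ^ 2)) * v ^ 2
        ≤ 1 / 2 * τ ^ 2 * ((ν ^ 4 * lam ^ 2 * τ) * (P ^ 3 * e ^ 2)) * v ^ 2 := by gcongr
      _ = _ := by rw [hX2]; ring
  have hkv2 : 1 / 2 * τ ^ 2 * (K3 ^ 2 * (P ^ 2 * e ^ 2)) * v ^ 2 ≤ K3 ^ 2 * X2 := by
    calc 1 / 2 * τ ^ 2 * (K3 ^ 2 * (P ^ 2 * e ^ 2)) * v ^ 2
        ≤ 1 * τ ^ 3 * (K3 ^ 2 * (P ^ 3 * e ^ 2)) * v ^ 2 := by gcongr; norm_num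
      _ = _ := by rw [hX2]; ring
  constructor
  · intro hK
    have h1 := mul_le_mul_of_nonneg_left (hlow hK) (by linarith : 0 ≤ τ)
    have h2 : c1 * X1 + ν ^ 4 * lam ^ 2 * X2
        = τ * (c1 * (P * e * G) + ν ^ 4 * lam ^ 2 * (τ ^ 2 * (P ^ 3 * e ^ 2) * v ^ 2)) := by
      rw [hX1, hX2]; ring
    have h3 : c1 ≤ 1 / 2 * (ν ^ 4 * lam ^ 2) := by
      rw [hc1]
      have : 1 / 2 * (ν ^ 2 * lam ^ 2) * 1 ≤ 1 / 2 * (ν ^ 2 * lam ^ 2) * ν ^ 2 := by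
        gcongr; linarith
      have : 0 ≤ ν ^ 2 * lam ^ 2 := by positivity
      linarith
    have h4 : c1 * X2 ≤ 1 / 2 * (ν ^ 4 * lam ^ 2) * X2 := by gcongr
    have h5 : c1 * (X1 + X2) ≤ 1 / 2 * E ^ 2 * Lw ^ 2 - τ * dv := by linarith
    refine le_trans ?_ h5
    have h6 : E ^ 2 * (w ^ 2 + H2) + τ * (E ^ 2 * w ^ 2) ≤ (10 * ν ^ 2 + 1) * (X1 + X2) := by
      rw [mul_add, hEw]
      have : 4 * X1 ≤ ν ^ 2 * X1 := by gcongr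
      have : 4 * X2 ≤ ν ^ 2 * X2 := by gcongr
      linarith
    rw [div_mul_eq_mul_div, div_le_iff₀ (by positivity)]
    calc _ ≤ c1 * ((10 * ν ^ 2 + 1) * (X1 + X2)) := by gcongr
      _ = _ := by ring
  · have h1 := mul_le_mul_of_nonneg_left hcr (by linarith : 0 ≤ τ)
    have h2 : K2 * (X1 + X2) = τ * (K2 * (P * e * G + τ ^ 2 * (P ^ 3 * e ^ 2) * v ^ 2)) := by
      rw [hX1, hX2]; ring
    have h5 : -((K2 + K3 ^ 2) * (X1 + X2)) ≤ 1 / 2 * E ^ 2 * Lw ^ 2 - τ * dv := by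
      have : 0 ≤ K3 ^ 2 * X1 := by positivity
      linarith
    refine le_trans (neg_le_neg ?_) h5
    have hY : 0 ≤ E ^ 2 * (w ^ 2 + H2) := by positivity
    have h7 : X1 + X2 ≤ (3 + 8 * ν ^ 2) * (τ ^ 3 * (P ^ 3 * e ^ 2)) * (E ^ 2 * (w ^ 2 + H2)) := by
      have hx2 : X2 = (τ ^ 3 * (P ^ 3 * e ^ 2)) * (E ^ 2 * w ^ 2) := by rw [hX2, hEw]
      have hx1 : X1 ≤ 2 * ((τ ^ 3 * (P ^ 3 * e ^ 2)) * (E ^ 2 * H2)) + 8 * ν ^ 2 * X2 := by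
        have a1 : X1 ≤ τ * (P * e) * (2 * E ^ 2 * H2
            + 2 * τ ^ 2 * (4 * ν ^ 2 * P ^ 2 * e ^ 2 * s) * v ^ 2) := by
          rw [hX1]
          calc τ * (P * e * G) = τ * (P * e) * G := by ring
            _ ≤ _ := by gcongr
        have a2 : τ * (P * e) * (2 * E ^ 2 * H2) ≤ τ ^ 3 * (P ^ 3 * e ^ 2) * (2 * E ^ 2 * H2) := by
          have : τ ≤ τ ^ 3 := le_self_pow₀ hτ (by norm_num)
          have : P ≤ P ^ 3 := le_self_pow₀ hP (by norm_num)
          gcongr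
        have a3 : τ * (P * e) * (2 * τ ^ 2 * (4 * ν ^ 2 * P ^ 2 * e ^ 2 * s) * v ^ 2)
            = 8 * ν ^ 2 * X2 * (e * s) := by rw [hX2]; ring
        have a4 : 8 * ν ^ 2 * X2 * (e * s) ≤ 8 * ν ^ 2 * X2 * 1 := by gcongr
        linarith
      have a5 : 0 ≤ (τ ^ 3 * (P ^ 3 * e ^ 2)) * (E ^ 2 * H2) := by positivity
      have a6 : 0 ≤ ν ^ 2 * ((τ ^ 3 * (P ^ 3 * e ^ 2)) * (E ^ 2 * H2)) := by positivity
      have a7 : (3 + 8 * ν ^ 2) * (τ ^ 3 * (P ^ 3 * e ^ 2)) * (E ^ 2 * (w ^ 2 + H2))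
          = (3 + 8 * ν ^ 2) * X2 + 3 * ((τ ^ 3 * (P ^ 3 * e ^ 2)) * (E ^ 2 * H2))
            + 8 * (ν ^ 2 * ((τ ^ 3 * (P ^ 3 * e ^ 2)) * (E ^ 2 * H2))) := by rw [hx2]; ring
      rw [a7]
      linarith
    calc (K2 + K3 ^ 2) * (X1 + X2)
        ≤ (K2 + K3 ^ 2) * ((3 + 8 * ν ^ 2) * (τ ^ 3 * (P ^ 3 * e ^ 2)) * (E ^ 2 * (w ^ 2 + H2))) := by
          gcongr
      _ = _ := by ring


/-- The conjugated function. -/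
def cv {n : ℕ} (τ : ℝ) (N : ℕ) (x0 : Eu n) (r : ℝ) (w : Eu n → ℝ) (y : Eu n) : ℝ :=
  Real.exp (τ * wE x0 r y ^ N) * w y

/-- The divergence term. -/
def cdiv {n : ℕ} (τ : ℝ) (N : ℕ) (A : Fin n → Fin n → Eu n → ℝ) (x0 : Eu n) (r : ℝ)
    (w : Eu n → ℝ) (x : Eu n) : ℝ :=
  ∑ i, pd i (VF (τ ^ 2) A (cv τ N x0 r w) (wX N A x0 r) (wh N A x0 r) (wp N A x0 r) i) x

lemma wE_contDiff {n : ℕ} (x0 : Eu n) {r : ℝ} (hr : 0 < r) {k : WithTop ℕ∞} :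
    ContDiff ℝ k (wE x0 r) := by
  unfold wE
  refine ContDiff.inv ?_ fun y => ?_
  · fun_prop
  · have : 0 ≤ ∑ k, (y k - x0 k) * (y k - x0 k) := Finset.sum_nonneg fun k _ => mul_self_nonneg _
    positivity

lemma cv_contDiffAt {n : ℕ} (τ : ℝ) (N : ℕ) (x0 : Eu n) {r : ℝ} (hr : 0 < r) {w : Eu n → ℝ}
    {x : Eu n} {k : WithTop ℕ∞} (hw : ContDiffAt ℝ k w x) : ContDiffAt ℝ k (cv τ N x0 r w) x := by
  unfold cv
  have := (wE_contDiff x0 hr (k := k)).contDiffAt (x := x)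
  exact ((contDiffAt_const.mul (this.pow N)).exp).mul hw

set_option maxHeartbeats 2000000 in
lemma carleman_pt {n : ℕ} (hn : n = 2 ∨ n = 3) {lam B : ℝ} (hlam : 0 < lam) (hB : 1 ≤ B) :
    ∃ N : ℕ, 1 ≤ N ∧ ∃ c > 0, ∃ K > 0, ∃ τ0 ≥ 1, ∀ (A : Fin n → Fin n → Eu n → ℝ) (w : Eu n → ℝ)
      (x x0 : Eu n) (r τ : ℝ), 0 < r → (∀ i j, DifferentiableAt ℝ (A i j) x) →
      (∀ i j, |A i j x| ≤ B) → (∀ k i j, |pd k (A i j) x| ≤ B) → (∀ i j, A i j x = A j i x) →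
      (∀ ξ : Fin n → ℝ, lam * ∑ i, ξ i ^ 2 ≤ ∑ i, ∑ j, A i j x * ξ i * ξ j) →
      ContDiffAt ℝ 2 w x → 1 ≤ wE x0 r x → τ0 ≤ τ →
      (r ^ 2 ≤ ∑ i, (x i - x0 i) ^ 2 →
        c * (Real.exp (τ * wE x0 r x ^ N) ^ 2 * (w x ^ 2 + ∑ i, pd i w x ^ 2)
          + τ * (Real.exp (τ * wE x0 r x ^ N) ^ 2 * w x ^ 2)) ≤
        1 / 2 * Real.exp (τ * wE x0 r x ^ N) ^ 2 * Lop A w x ^ 2 - τ * cdiv τ N A x0 r w x) ∧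
      -(K * (τ ^ 3 * ((wE x0 r x ^ N) ^ 3 * wE x0 r x ^ 2)) *
        (Real.exp (τ * wE x0 r x ^ N) ^ 2 * (w x ^ 2 + ∑ i, pd i w x ^ 2))) ≤
        1 / 2 * Real.exp (τ * wE x0 r x ^ N) ^ 2 * Lop A w x ^ 2 - τ * cdiv τ N A x0 r w x := by
  obtain ⟨C, hC⟩ : ∃ C, C = 500 * B ^ 2 := ⟨_, rfl⟩
  have hC0 : 0 < C := by rw [hC]; positivity
  obtain ⟨N, hN⟩ := exists_nat_ge (2 + 4 * C / lam ^ 2)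
  obtain ⟨ν, hν⟩ : ∃ ν : ℝ, ν = N := ⟨_, rfl⟩
  rw [← hν] at hN
  have hq0 : 0 ≤ 4 * C / lam ^ 2 := by positivity
  have hν2 : 2 ≤ ν := by linarith
  have hν4 : 4 * C ≤ ν * lam ^ 2 := by
    rw [← div_le_iff₀ (by positivity)]; linarith
  obtain ⟨K0, hK0⟩ : ∃ K, K = 2 * (256 * ν ^ 4 * (ν + 2) ^ 2 * C ^ 4 + 64 * ν ^ 4 * C ^ 2) :=
    ⟨_, rfl⟩
  have hK00 : 0 ≤ K0 := by rw [hK0]; positivity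
  obtain ⟨K3, hK3⟩ : ∃ K, K = 4 * ν * (ν + 1) * C + 2 * ν * C + 8 * ν ^ 2 * C := ⟨_, rfl⟩
  have hK30 : 0 < K3 := by rw [hK3]; positivity
  obtain ⟨K2, hK2⟩ : ∃ K, K = 2 * ν * C + 1 + K0 + 8 * ν ^ 3 * C := ⟨_, rfl⟩
  have hK20 : 0 < K2 := by rw [hK2]; positivity
  obtain ⟨c1, hc1⟩ : ∃ c1, c1 = 1 / 4 * ν ^ 2 * lam ^ 2 := ⟨_, rfl⟩
  have hc10 : 0 < c1 := by rw [hc1]; positivity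
  have hN1 : 1 ≤ N := by
    have : (1 : ℝ) ≤ (N : ℝ) := by rw [← hν]; linarith
    exact_mod_cast this
  refine ⟨N, hN1, c1 / (10 * ν ^ 2 + 1), by positivity, (K2 + K3 ^ 2) * (3 + 8 * ν ^ 2),
    by positivity, 1 + K0 / (ν ^ 6 * lam ^ 4) + K3 ^ 2 / (ν ^ 4 * lam ^ 2), ?_, ?_⟩
  · have : 0 ≤ K0 / (ν ^ 6 * lam ^ 4) := by positivity
    have : 0 ≤ K3 ^ 2 / (ν ^ 4 * lam ^ 2) := by positivity
    linarith
  intro A w x x0 r τ hr hAd hAB hdAB hsym hell hw he1 hτ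
  have hq1 : 0 ≤ K0 / (ν ^ 6 * lam ^ 4) := by positivity
  have hq2 : 0 ≤ K3 ^ 2 / (ν ^ 4 * lam ^ 2) := by positivity
  have hτ1 : 1 ≤ τ := by linarith
  have hσ : K0 ≤ ν ^ 6 * lam ^ 4 * τ ^ 2 := by
    have h1 : K0 / (ν ^ 6 * lam ^ 4) ≤ τ := by linarith
    rw [div_le_iff₀ (by positivity)] at h1
    have h2 : τ ≤ τ ^ 2 := le_self_pow₀ hτ1 (by norm_num)
    calc K0 ≤ τ * (ν ^ 6 * lam ^ 4) := h1
      _ ≤ τ ^ 2 * (ν ^ 6 * lam ^ 4) := by gcongr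
      _ = _ := by ring
  have hτ3 : K3 ^ 2 ≤ ν ^ 4 * lam ^ 2 * τ := by
    have h1 : K3 ^ 2 / (ν ^ 4 * lam ^ 2) ≤ τ := by linarith
    rw [div_le_iff₀ (by positivity)] at h1
    linarith
  have hσ1 : 1 ≤ τ ^ 2 := one_le_pow₀ hτ1
  -- data
  obtain ⟨e, he⟩ : ∃ e, e = wE x0 r x := ⟨_, rfl⟩
  obtain ⟨P, hP⟩ : ∃ P, P = e ^ N := ⟨_, rfl⟩
  obtain ⟨E, hE⟩ : ∃ E, E = Real.exp (τ * P) := ⟨_, rfl⟩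
  obtain ⟨v, hv⟩ : ∃ v, v = cv τ N x0 r w := ⟨_, rfl⟩
  obtain ⟨z, hz⟩ : ∃ z : Fin n → ℝ, z = fun i => x i - x0 i := ⟨_, rfl⟩
  obtain ⟨g, hg⟩ : ∃ g : Fin n → ℝ, g = fun i => pd i v x := ⟨_, rfl⟩
  obtain ⟨Y, hY⟩ : ∃ Y : Fin n → ℝ, Y = fun i => wY A x0 i x := ⟨_, rfl⟩
  obtain ⟨F, hF⟩ : ∃ F : Fin n → ℝ, F = fun i => ∑ j, A i j x * g j := ⟨_, rfl⟩
  obtain ⟨dY, hdY⟩ : ∃ dY : Fin n → Fin n → ℝ,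
    dY = fun i k => A k i x + ∑ j, pd i (A k j) x * (x j - x0 j) := ⟨_, rfl⟩
  obtain ⟨dQ, hdQ⟩ : ∃ dQ : Fin n → ℝ,
    dQ = fun i => wY A x0 i x + ∑ k, (x k - x0 k) * dY i k := ⟨_, rfl⟩
  obtain ⟨s, hs⟩ : ∃ s, s = ∑ i, z i ^ 2 := ⟨_, rfl⟩
  obtain ⟨G, hG⟩ : ∃ G, G = ∑ i, g i ^ 2 := ⟨_, rfl⟩
  rw [← he] at he1
  have hs0 : 0 ≤ s := hs ▸ Finset.sum_nonneg fun i _ => sq_nonneg _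
  have hG0 : 0 ≤ G := hG ▸ Finset.sum_nonneg fun i _ => sq_nonneg _
  have hes' : e * (s + r ^ 2) = 1 := by
    have h1 : s + r ^ 2 = ∑ k, (x k - x0 k) * (x k - x0 k) + r ^ 2 := by
      rw [hs, hz]; simp only [sq]
    have : 0 < s + r ^ 2 := by positivity
    rw [he, wE, ← h1, inv_mul_cancel₀ this.ne']
  have hes : e * s ≤ 1 := by
    have : 0 ≤ e * r ^ 2 := by positivity
    linarith
  have hs1 : s ≤ 1 := le_trans (le_mul_of_one_le_left hs0 he1) hes
  have hP1 : 1 ≤ P := hP ▸ one_le_pow₀ he1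
  have hE0 : 0 < E := hE ▸ Real.exp_pos _
  have hvc : ContDiffAt ℝ 2 v x := hv ▸ cv_contDiffAt τ N x0 hr hw
  have hA : ∀ i j, HP (A i j) x (fun k => pd k (A i j) x) := fun i j => HP.of_diff (hAd i j)
  have hvg : HP v x g := by
    rw [hg]; exact HP.of_diff (hvc.differentiableAt (by norm_num))
  have hYd : ∀ k, HP (wY A x0 k) x (fun i => dY i k) := fun k => by
    rw [hdY]; exact HP_wY (fun i j => hA i j) k
  have hQd : HP (wQ A x0) x dQ := by rw [hdQ]; exact HP_wQ hYd
  have hR := rellich_w hn (τ ^ 2) N A v x x0 hr (fun k i j => pd k (A i j) x) g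
    (fun i j => pd i (pd j v) x) dY dQ hA hvg (fun j => pd_hp hvc j) hsym
    (fun i j => pd_symm hvc i j) hYd hQd P e he hP F Y z hF hY hz
  have hcj := conj_w hn τ N A w v x x0 hr (fun k i j => pd k (A i j) x) hA hsym hw hv P e he hP Y z
    hY hz
  obtain ⟨hgv, hcj⟩ := hcj
  obtain ⟨bQ, bW, bZ1, bZ2, bZ3, bdY⟩ := data_bounds hn hB (fun i j => A i j x)
    (fun k i j => pd k (A i j) x) z g Y F dQ dY hAB hdAB hs hG hs1
    (fun k => by rw [hY, hz]; rfl) (fun k => by rw [hF]) (fun i k => by rw [hdY, hz])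
    (fun i => by rw [hdQ, hY, hz])
  rw [← hC] at bQ bW bZ1 bZ2 bZ3 bdY
  have hQl : lam * s ≤ ∑ k, z k * Y k := by
    refine (hs ▸ hell z).trans (le_of_eq ?_)
    rw [hY]; simp only [wY, Finset.mul_sum, hz]
    refine Finset.sum_congr rfl fun i _ => Finset.sum_congr rfl fun j _ => by ring
  have hql : lam * G ≤ ∑ k, g k * F k := by
    refine (hG ▸ hell g).trans (le_of_eq ?_)
    rw [hF]; simp only [Finset.mul_sum]
    refine Finset.sum_congr rfl fun i _ => Finset.sum_congr rfl fun j _ => by ring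
  rw [← hν] at hR hcj
  have hwh : wh N A x0 r x = 8 * ν ^ 2 * ((P * e) * e * (∑ k, z k * Y k)) := by
    rw [wh, ← he, ← hP, hν, hz, hY]; rfl
  have hfs : ∑ j, (-2 * ν * (P * e) * z j) ^ 2 = 4 * ν ^ 2 * P ^ 2 * e ^ 2 * s := by
    rw [hs, Finset.mul_sum]
    exact Finset.sum_congr rfl fun i _ => by ring
  have hvx : v x = E * w x := by rw [hv, cv, hE, hP, he]
  have hgj : ∀ j, g j = E * pd j w x + τ * (-2 * ν * (P * e) * z j) * v x := fun j => by
    have := hgv j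
    rw [← hE] at this
    rw [hg]; beta_reduce; rw [this, hvx, hν]; ring
  have h2G : G ≤ 2 * E ^ 2 * (∑ i, pd i w x ^ 2)
      + 2 * τ ^ 2 * (4 * ν ^ 2 * P ^ 2 * e ^ 2 * s) * v x ^ 2 := by
    rw [hG, ← hfs, Finset.mul_sum, Finset.mul_sum, Finset.sum_mul, ← Finset.sum_add_distrib]
    refine Finset.sum_le_sum fun i _ => ?_
    rw [hgj]
    nlinarith [sq_nonneg (E * pd i w x - τ * (-2 * ν * (P * e) * z i) * v x)]
  have h2w : E ^ 2 * (∑ i, pd i w x ^ 2) ≤ 2 * G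
      + 2 * τ ^ 2 * (4 * ν ^ 2 * P ^ 2 * e ^ 2 * s) * v x ^ 2 := by
    rw [hG, ← hfs, Finset.mul_sum, Finset.mul_sum, Finset.mul_sum, Finset.sum_mul,
      ← Finset.sum_add_distrib]
    refine Finset.sum_le_sum fun i _ => ?_
    have : E ^ 2 * pd i w x ^ 2 = (g i - τ * (-2 * ν * (P * e) * z i) * v x) ^ 2 := by
      rw [hgj]; ring
    rw [this]
    nlinarith [sq_nonneg (g i + τ * (-2 * ν * (P * e) * z i) * v x)]
  have hRb : |(∑ i, (-2 * ν) * ((-2 * (ν + 1) * (P * e ^ 2) * z i) * Y i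
          + P * e * (A i i x + ∑ j, pd i (A i j) x * z j))) - wh N A x0 r x| ≤ K3 * (P * e) := by
    have h1 : (∑ i, (-2 * ν) * ((-2 * (ν + 1) * (P * e ^ 2) * z i) * Y i
          + P * e * (A i i x + ∑ j, pd i (A i j) x * z j)))
        = 4 * ν * (ν + 1) * (P * e ^ 2) * (∑ k, z k * Y k) - 2 * ν * (P * e) * (∑ i, dY i i) := by
      rw [Finset.mul_sum, Finset.mul_sum, ← Finset.sum_sub_distrib]
      refine Finset.sum_congr rfl fun i _ => ?_
      rw [hdY, hz]; ring
    have bQ' : |∑ k, z k * Y k| ≤ C * s := by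
      refine abs_le_of_sq_le_sq ?_ (by positivity)
      rw [mul_pow]; exact bQ
    have heQ : e * |∑ k, z k * Y k| ≤ C := by
      calc e * |∑ k, z k * Y k| ≤ e * (C * s) := by gcongr
        _ = C * (e * s) := by ring
        _ ≤ C * 1 := by gcongr
        _ = C := by ring
    rw [h1, hwh]
    calc _ = |(P * e) * ((4 * ν * (ν + 1)) * (e * ∑ k, z k * Y k)
          - 2 * ν * (∑ i, dY i i) - 8 * ν ^ 2 * (e * ∑ k, z k * Y k))| := by congr 1; ring
      _ = (P * e) * |(4 * ν * (ν + 1)) * (e * ∑ k, z k * Y k)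
          - 2 * ν * (∑ i, dY i i) - 8 * ν ^ 2 * (e * ∑ k, z k * Y k)| := by
          rw [abs_mul, abs_of_pos (by positivity : 0 < P * e)]
      _ ≤ (P * e) * K3 := by
          gcongr
          have a1 : |e * ∑ k, z k * Y k| ≤ C := by
            rw [abs_mul, abs_of_pos (by positivity : 0 < e)]; exact heQ
          have a2 : |(4 * ν * (ν + 1)) * (e * ∑ k, z k * Y k)| ≤ 4 * ν * (ν + 1) * C := by
            rw [abs_mul, abs_of_pos (by positivity : 0 < 4 * ν * (ν + 1))]; gcongr
          have a3 : |2 * ν * (∑ i, dY i i)| ≤ 2 * ν * C := by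
            rw [abs_mul, abs_of_pos (by positivity : 0 < 2 * ν)]; gcongr
          have a4 : |8 * ν ^ 2 * (e * ∑ k, z k * Y k)| ≤ 8 * ν ^ 2 * C := by
            rw [abs_mul, abs_of_pos (by positivity : 0 < 8 * ν ^ 2)]; gcongr
          rw [hK3]
          have b1 := abs_sub ((4 * ν * (ν + 1)) * (e * ∑ k, z k * Y k)
            - 2 * ν * (∑ i, dY i i)) (8 * ν ^ 2 * (e * ∑ k, z k * Y k))
          have b2 := abs_sub ((4 * ν * (ν + 1)) * (e * ∑ k, z k * Y k)) (2 * ν * (∑ i, dY i i))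
          linarith
      _ = _ := by ring
  have hH0 : 0 ≤ ∑ i, pd i w x ^ 2 := Finset.sum_nonneg fun i _ => sq_nonneg _
  have hlow := fun h12 : 1 / 2 ≤ e * s => quad_lower (v := v x) hlam hC0 hs0 hG0 hP1 he1 hes h12
    hQl bQ bW hql bZ1 bZ2 bZ3 hν2 hν4 hK0 hσ hσ1
  have hcr := quad_crude (v := v x) hC0 hs0 hG0 hP1 he1 hes
    (le_trans (by positivity) hQl) bQ bW (le_trans (by positivity) hql) bZ1 bZ2 bZ3 hν2 hK0 hσ1
  rw [← hc1] at hlow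
  rw [← hK2] at hcr
  have hgg : ∀ k, pd k v x = g k := fun k => by rw [hg]
  simp only [hgg] at hcj
  rw [← hE] at hcj
  have hfin := pt_scalar hlam hC0 hν2 hP1 he1 hs0 hG0 hes hτ1 hH0 hE0 hvx hR hcj hRb hK20.le hτ3 hc1
    hlow hcr h2G h2w
  rw [← he, ← hP, ← hE, cdiv, ← hv]
  refine ⟨fun hrs => hfin.1 ?_, hfin.2⟩
  have h1 : r ^ 2 ≤ s := by rw [hs, hz]; exact hrs
  have h2 : e * r ^ 2 ≤ e * s := by gcongr
  linarith


lemma norm_fderiv_sq {n : ℕ} (f : Eu n → ℝ) (x : Eu n) :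
    ‖fderiv ℝ f x‖ ^ 2 = ∑ i, pd i f x ^ 2 := by
  obtain ⟨y, hy⟩ := (InnerProductSpace.toDual ℝ (Eu n)).surjective (fderiv ℝ f x)
  have h1 : ∀ i, pd i f x = y i := fun i => by
    unfold pd
    rw [← hy, InnerProductSpace.toDual_apply_apply]
    simp [EuclideanSpace.inner_single_right]
  rw [← hy, LinearIsometryEquiv.norm_map, EuclideanSpace.norm_sq_eq]
  exact Finset.sum_congr rfl fun i _ => by rw [h1]; simp

lemma pd_germ {n : ℕ} {f g : Eu n → ℝ} {x : Eu n} (h : f =ᶠ[nhds x] g) (i : Fin n) :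
    pd i f =ᶠ[nhds x] pd i g := by
  filter_upwards [h.fderiv (𝕜 := ℝ)] with y hy
  unfold pd; rw [hy]

lemma Lop_germ {n : ℕ} (A : Fin n → Fin n → Eu n → ℝ) {f g : Eu n → ℝ} {x : Eu n}
    (h : f =ᶠ[nhds x] g) : Lop A f x = Lop A g x := by
  unfold Lop
  refine Finset.sum_congr rfl fun i _ => Finset.sum_congr rfl fun j _ => ?_
  refine (pd_germ ?_ i).self_of_nhds
  filter_upwards [pd_germ h j] with y hy
  rw [hy]

lemma exists_cutoff {n : ℕ} {R : ℝ} (hR : 0 < R) : ∃ χ : Eu n → ℝ, ContDiff ℝ 2 χ ∧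
    (∀ z : Eu n, ‖z‖ < R / 2 → χ =ᶠ[nhds z] fun _ => 1) ∧
    (∀ z : Eu n, 3 / 4 * R < ‖z‖ → χ =ᶠ[nhds z] fun _ => 0) ∧
    ∃ b > 0, ∀ z : Eu n, ‖z‖ ≤ R → |χ z| ≤ b ∧ (∀ j, |pd j χ z| ≤ b) ∧
      ∀ i j, |pd i (pd j χ) z| ≤ b := by
  let φ : ContDiffBump (0 : Eu n) := ⟨R / 2, 3 / 4 * R, by positivity, by linarith⟩
  have hφ : ContDiff ℝ 2 φ := φ.contDiff
  refine ⟨φ, hφ, fun z hz => ?_, fun z hz => ?_, ?_⟩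
  · filter_upwards [(isOpen_lt continuous_norm continuous_const).mem_nhds hz] with y hy
    exact φ.one_of_mem_closedBall (by simpa using le_of_lt hy)
  · filter_upwards [(isOpen_lt continuous_const continuous_norm).mem_nhds hz] with y hy
    exact φ.zero_of_le_dist (by simpa using le_of_lt hy)
  · have hc1 : ∀ j, ContDiff ℝ 1 (pd j φ) := fun j =>
      contDiff_iff_contDiffAt.2 fun x => pd_c1 hφ.contDiffAt j
    have hc2 : ∀ i j, Continuous (pd i (pd j φ)) := fun i j => by
      have := (hc1 j).continuous_fderiv (by norm_num)
      exact this.clm_apply continuous_const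
    have hK := isCompact_closedBall (0 : Eu n) R
    obtain ⟨b0, hb0⟩ := hK.exists_bound_of_continuousOn hφ.continuous.continuousOn
    choose b1 hb1 using fun j => hK.exists_bound_of_continuousOn (hc1 j).continuous.continuousOn
    choose b2 hb2 using fun i j => hK.exists_bound_of_continuousOn (hc2 i j).continuousOn
    have hn1 : 0 ≤ ∑ j, |b1 j| := Finset.sum_nonneg fun _ _ => abs_nonneg _
    have hn2 : 0 ≤ ∑ i, ∑ j, |b2 i j| :=
      Finset.sum_nonneg fun _ _ => Finset.sum_nonneg fun _ _ => abs_nonneg _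
    refine ⟨1 + |b0| + ∑ j, |b1 j| + ∑ i, ∑ j, |b2 i j|, by positivity, fun z hz => ?_⟩
    have hz' : z ∈ closedBall (0 : Eu n) R := by simpa using hz
    refine ⟨?_, fun j => ?_, fun i j => ?_⟩
    · have := hb0 z hz'
      rw [Real.norm_eq_abs] at this
      linarith [le_abs_self b0]
    · have := hb1 j z hz'
      rw [Real.norm_eq_abs] at this
      have h2 := Finset.single_le_sum (f := fun j => |b1 j|) (fun _ _ => abs_nonneg _)
        (Finset.mem_univ j)
      have := le_abs_self (b1 j)
      have := abs_nonneg b0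
      linarith
    · have := hb2 i j z hz'
      rw [Real.norm_eq_abs] at this
      have h2 := Finset.single_le_sum (f := fun j => |b2 i j|) (fun _ _ => abs_nonneg _)
        (Finset.mem_univ j)
      have h3 := Finset.single_le_sum (f := fun i => ∑ j, |b2 i j|)
        (fun _ _ => Finset.sum_nonneg fun _ _ => abs_nonneg _) (Finset.mem_univ i)
      have := le_abs_self (b2 i j)
      have := abs_nonneg b0
      linarith

lemma pd_translate {n : ℕ} (f : Eu n → ℝ) (x0 : Eu n) (i : Fin n) (x : Eu n) :
    pd i (fun y => f (y - x0)) x = pd i f (x - x0) := by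
  unfold pd
  rw [fderiv_comp_sub]

/-- `Lop` of a product with a cutoff. -/
lemma Lop_mul_bound {n : ℕ} (hn : n = 2 ∨ n = 3) (A : Fin n → Fin n → Eu n → ℝ) (χ u : Eu n → ℝ)
    (x : Eu n) {b B M L : ℝ} (hb : 0 < b) (hB : 1 ≤ B) (hM : 0 < M)
    (hχ : ContDiffAt ℝ 2 χ x) (hu : ContDiffAt ℝ 2 u x) (hA : ∀ i j, DifferentiableAt ℝ (A i j) x)
    (hAB : ∀ i j, |A i j x| ≤ B) (hdAB : ∀ k i j, |pd k (A i j) x| ≤ B)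
    (hχ0 : |χ x| ≤ b) (hχ1 : ∀ j, |pd j χ x| ≤ b) (hχ2 : ∀ i j, |pd i (pd j χ) x| ≤ b)
    (hu0 : |u x| ≤ M) (hu1 : ∀ j, |pd j u x| ≤ M) (hL : |Lop A u x| ≤ L) :
    |Lop A (fun y => χ y * u y) x| ≤ b * L + 36 * (B * b * M) := by
  have key : ∀ i j, pd i (fun y => A i j y * pd j (fun y => χ y * u y) y) x =
      χ x * pd i (fun y => A i j y * pd j u y) x + (pd i (A i j) x * (pd j χ x * u x)
        + (A i j x * (pd i (pd j χ) x * u x) + (A i j x * (pd j χ x * pd i u x)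
        + A i j x * (pd i χ x * pd j u x)))) := by
    intro i j
    have hg : (fun y => A i j y * pd j (fun y => χ y * u y) y) =ᶠ[nhds x]
        (fun y => A i j y * (χ y * pd j u y + u y * pd j χ y)) := by
      filter_upwards [hχ.eventually (by simp), hu.eventually (by simp)] with y h1 h2
      have h3 := (HP.of_diff (h1.differentiableAt (by norm_num))).mul
        (HP.of_diff (h2.differentiableAt (by norm_num)))
      rw [h3.2 j]; ring
    have hc := HP.of_diff (hχ.differentiableAt (by norm_num))
    have hu' := HP.of_diff (hu.differentiableAt (by norm_num))
    have ha := HP.of_diff (hA i j)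
    have h1 := (ha.mul ((hc.mul (pd_hp hu j)).add (hu'.mul (pd_hp hχ j)))).congr_f hg
    rw [h1.2 i, (ha.mul (pd_hp hu j)).2 i]
    ring
  have h1 : Lop A (fun y => χ y * u y) x = χ x * Lop A u x
      + ∑ i, ∑ j, (pd i (A i j) x * (pd j χ x * u x)
        + (A i j x * (pd i (pd j χ) x * u x) + (A i j x * (pd j χ x * pd i u x)
        + A i j x * (pd i χ x * pd j u x)))) := by
    unfold Lop
    simp only [key, Finset.sum_add_distrib, Finset.mul_sum]
  rw [h1]
  refine (abs_add_le _ _).trans (add_le_add ?_ ?_)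
  · rw [abs_mul]; gcongr
  · have h2 : 36 * (B * b * M) = 3 * (3 * (4 * (B * b * M))) := by ring
    rw [h2]
    refine sum_le3 hn _ _ fun i => sum_le3 hn _ _ fun j => ?_
    have a1 := abs_mul_le' (hdAB i i j) (abs_mul_le' (hχ1 j) hu0)
    have a2 := abs_mul_le' (hAB i j) (abs_mul_le' (hχ2 i j) hu0)
    have a3 := abs_mul_le' (hAB i j) (abs_mul_le' (hχ1 j) (hu1 i))
    have a4 := abs_mul_le' (hAB i j) (abs_mul_le' (hχ1 i) (hu1 j))
    refine (abs_add_le _ _).trans ?_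
    refine (add_le_add_right (abs_add_le _ _) _).trans ?_
    refine (add_le_add_right (add_le_add_right (abs_add_le _ _) _) _).trans ?_
    linarith


lemma integral_pd_zero {n : ℕ} {f : Eu n → ℝ} (hf : ContDiff ℝ 1 f) (hc : HasCompactSupport f)
    (i : Fin n) : Integrable (pd i f) ∧ ∫ x, pd i f x = 0 := by
  have h1 : Continuous (pd i f) :=
    (hf.continuous_fderiv (by norm_num)).clm_apply continuous_const
  have h2 : HasCompactSupport (pd i f) := by
    refine (hc.fderiv (𝕜 := ℝ)).mono fun x hx => ?_
    intro h; apply hx; unfold pd; rw [h]; simp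
  have hi : Integrable (pd i f) := h1.integrable_of_hasCompactSupport h2
  refine ⟨hi, ?_⟩
  have h3 := integral_mul_fderiv_eq_neg_fderiv_mul_of_integrable (μ := (volume : Measure (Eu n)))
    (f := fun _ => (1 : ℝ)) (g := f) (v := EuclideanSpace.single i 1) (by simp)
    (by simp only [one_mul]; exact hi) (by simpa using hf.continuous.integrable_of_hasCompactSupport hc)
    (by simp) (fun x _ => (hf.differentiable (by norm_num)) x)
  simp at h3
  exact h3

lemma VF_contDiffAt {n : ℕ} (σ : ℝ) (A : Fin n → Fin n → Eu n → ℝ) (v : Eu n → ℝ) (N : ℕ)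
    (x0 : Eu n) {r : ℝ} (hr : 0 < r) (i : Fin n) {x : Eu n} (hv : ContDiffAt ℝ 2 v x)
    (hA : ∀ i j, ContDiffAt ℝ 1 (A i j) x) :
    ContDiffAt ℝ 1 (VF σ A v (wX N A x0 r) (wh N A x0 r) (wp N A x0 r) i) x := by
  have hE : ContDiffAt ℝ 1 (wE x0 r) x := (wE_contDiff x0 hr).contDiffAt
  have hpd : ∀ j, ContDiffAt ℝ 1 (pd j v) x := fun j => pd_c1 hv j
  have hv1 : ContDiffAt ℝ 1 v x := hv.of_le (by norm_num)
  have hco : ∀ j, ContDiffAt ℝ 1 (fun y : Eu n => y j - x0 j) x := fun j => by fun_prop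
  have hY : ∀ k, ContDiffAt ℝ 1 (wY A x0 k) x := fun k =>
    ContDiffAt.sum fun j _ => (hA k j).mul (hco j)
  have hQ : ContDiffAt ℝ 1 (wQ A x0) x := ContDiffAt.sum fun k _ => (hco k).mul (hY k)
  have hPE : ContDiffAt ℝ 1 (fun y => wE x0 r y ^ N * wE x0 r y) x := (hE.pow N).mul hE
  have hX : ∀ k, ContDiffAt ℝ 1 (wX N A x0 r k) x := fun k =>
    contDiffAt_const.mul (hPE.mul (hY k))
  have hp : ContDiffAt ℝ 1 (wp N A x0 r) x := contDiffAt_const.mul ((hPE.mul hPE).mul hQ)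
  have hh : ContDiffAt ℝ 1 (wh N A x0 r) x := contDiffAt_const.mul ((hPE.mul hE).mul hQ)
  have hF : ∀ i, ContDiffAt ℝ 1 (fun y => ∑ j, A i j y * pd j v y) x := fun i =>
    ContDiffAt.sum fun j _ => (hA i j).mul (hpd j)
  have h1 : ContDiffAt ℝ 1 (fun y => ∑ k, wX N A x0 r k y * pd k v y) x :=
    ContDiffAt.sum fun j _ => (hX j).mul (hpd j)
  have h2 : ContDiffAt ℝ 1 (fun y => ∑ k, pd k v y * (∑ j, A k j y * pd j v y)) x :=
    ContDiffAt.sum fun j _ => (hpd j).mul (hF j)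
  exact (((contDiffAt_const.mul (h1.mul (hF i))).add (h2.mul (hX i))).sub
    ((hh.mul hv1).mul (hF i))).sub (contDiffAt_const.mul (((hp.mul hv1).mul hv1).mul (hX i)))

lemma VF_zero {n : ℕ} (σ : ℝ) (A : Fin n → Fin n → Eu n → ℝ) (v : Eu n → ℝ) (X : Fin n → Eu n → ℝ)
    (h p : Eu n → ℝ) (i : Fin n) {x : Eu n} (hv : v =ᶠ[nhds x] fun _ => 0) :
    VF σ A v X h p i =ᶠ[nhds x] fun _ => 0 := by
  have h1 : ∀ᶠ y in nhds x, ∀ j, pd j v y = 0 := by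
    rw [Filter.eventually_all]
    intro j
    filter_upwards [pd_germ hv j] with y hy
    rw [hy]; simp [pd]
  filter_upwards [hv, h1] with y hy h1
  simp [VF, hy, h1]

lemma cdiv_integral {n : ℕ} {Ω : Set (Eu n)} (hΩ : IsOpen Ω) (A : Fin n → Fin n → Eu n → ℝ)
    (hA : ∀ i j, ContDiffOn ℝ 1 (A i j) Ω) (w : Eu n → ℝ) (hw : ContDiffOn ℝ 2 w Ω) (x0 : Eu n)
    {ρ r τ : ℝ} (N : ℕ) (hr : 0 < r) (hρ : closedBall x0 ρ ⊆ Ω)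
    (hw0 : ∀ x, ρ < dist x x0 → w =ᶠ[nhds x] fun _ => 0) :
    Integrable (cdiv τ N A x0 r w) ∧ ∫ x, cdiv τ N A x0 r w x = 0 ∧
      ∀ x, ρ < dist x x0 → cdiv τ N A x0 r w x = 0 := by
  have hz : ∀ i, ∀ x, ρ < dist x x0 → VF (τ ^ 2) A (cv τ N x0 r w) (wX N A x0 r) (wh N A x0 r)
      (wp N A x0 r) i =ᶠ[nhds x] fun _ => 0 := fun i x hx => by
    refine VF_zero _ _ _ _ _ _ _ ?_
    filter_upwards [hw0 x hx] with y hy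
    simp [cv, hy]
  have hc : ∀ i, ContDiff ℝ 1 (VF (τ ^ 2) A (cv τ N x0 r w) (wX N A x0 r) (wh N A x0 r)
      (wp N A x0 r) i) := fun i => by
    rw [contDiff_iff_contDiffAt]
    intro x
    by_cases hx : dist x x0 ≤ ρ
    · have hxΩ : Ω ∈ nhds x := hΩ.mem_nhds (hρ hx)
      exact VF_contDiffAt _ _ _ _ _ hr _ (cv_contDiffAt _ _ _ hr (hw.contDiffAt hxΩ))
        (fun i j => (hA i j).contDiffAt hxΩ)
    · exact (contDiffAt_const (c := (0 : ℝ))).congr_of_eventuallyEq (hz i x (not_le.1 hx))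
  have hs : ∀ i, HasCompactSupport (VF (τ ^ 2) A (cv τ N x0 r w) (wX N A x0 r) (wh N A x0 r)
      (wp N A x0 r) i) := fun i => by
    refine HasCompactSupport.intro (isCompact_closedBall x0 ρ) fun x hx => ?_
    exact (hz i x (by simpa using hx)).self_of_nhds
  refine ⟨?_, ?_, ?_⟩
  · exact integrable_finsetSum _ fun i _ => (integral_pd_zero (hc i) (hs i) i).1
  · unfold cdiv
    rw [integral_finsetSum _ fun i _ => (integral_pd_zero (hc i) (hs i) i).1]
    exact Finset.sum_eq_zero fun i _ => (integral_pd_zero (hc i) (hs i) i).2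
  · intro x hx
    refine Finset.sum_eq_zero fun i _ => ?_
    rw [(pd_germ (hz i x hx) i).self_of_nhds]; simp [pd]


/-- The `H¹` energy density. -/
def En {n : ℕ} (u : Eu n → ℝ) (x : Eu n) : ℝ := u x ^ 2 + ‖fderiv ℝ u x‖ ^ 2

lemma En_nonneg {n : ℕ} (u : Eu n → ℝ) (x : Eu n) : 0 ≤ En u x := by unfold En; positivity

lemma En_eq {n : ℕ} (u : Eu n → ℝ) (x : Eu n) : En u x = u x ^ 2 + ∑ i, pd i u x ^ 2 := by
  unfold En; rw [norm_fderiv_sq]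

/-- Admissible functions: `C²`, `C¹`-bounded with `|Lu| ≤ Λ |u|`. -/
structure Adm {n : ℕ} (A : Fin n → Fin n → Eu n → ℝ) (Ω : Set (Eu n)) (Λ M : ℝ) (u : Eu n → ℝ) :
    Prop where
  c2 : ContDiffOn ℝ 2 u Ω
  hL : ∀ x ∈ Ω, |Lop A u x| ≤ Λ * |u x|
  b0 : ∀ x ∈ Ω, |u x| ≤ M
  b1 : ∀ x ∈ Ω, ‖fderiv ℝ u x‖ ≤ M

lemma En_cont {n : ℕ} {Ω : Set (Eu n)} (hΩ : IsOpen Ω) {u : Eu n → ℝ} (hu : ContDiffOn ℝ 2 u Ω) :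
    ContinuousOn (En u) Ω := by
  have h1 : ContinuousOn (fderiv ℝ u) Ω := hu.continuousOn_fderiv_of_isOpen hΩ (by norm_num)
  exact (hu.continuousOn.pow 2).add (h1.norm.pow 2)

lemma En_intOn {n : ℕ} {Ω : Set (Eu n)} (hΩ : IsOpen Ω) {u : Eu n → ℝ} (hu : ContDiffOn ℝ 2 u Ω)
    {x0 : Eu n} {ρ : ℝ} (h : closedBall x0 ρ ⊆ Ω) : IntegrableOn (En u) (ball x0 ρ) :=
  (((En_cont hΩ hu).mono h).integrableOn_compact (isCompact_closedBall x0 ρ)).mono_set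
    ball_subset_closedBall

lemma wE_eq {n : ℕ} (x0 x : Eu n) (r : ℝ) : wE x0 r x = (dist x x0 ^ 2 + r ^ 2)⁻¹ := by
  unfold wE
  rw [EuclideanSpace.dist_sq_eq]
  simp [Real.dist_eq, sq]

lemma dist_sq_sum {n : ℕ} (x0 x : Eu n) : ∑ i, (x i - x0 i) ^ 2 = dist x x0 ^ 2 := by
  rw [EuclideanSpace.dist_sq_eq]
  simp [Real.dist_eq]

lemma coeff_bound {n : ℕ} {Ω : Set (Eu n)} (hΩ : IsOpen Ω) (A : Fin n → Fin n → Eu n → ℝ)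
    (hA : ∀ i j, ContDiffOn ℝ 1 (A i j) Ω) {Kc : Set (Eu n)} (hK : IsCompact Kc) (hKΩ : Kc ⊆ Ω) :
    ∃ B : ℝ, 1 ≤ B ∧ ∀ x ∈ Kc, (∀ i j, |A i j x| ≤ B) ∧ ∀ k i j, |pd k (A i j) x| ≤ B := by
  have h1 : ∀ k i j, ContinuousOn (pd k (A i j)) Ω := fun k i j =>
    ((hA i j).continuousOn_fderiv_of_isOpen hΩ (by norm_num)).clm_apply continuousOn_const
  choose b0 hb0 using fun i j => hK.exists_bound_of_continuousOn ((hA i j).continuousOn.mono hKΩ)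
  choose b1 hb1 using fun k i j => hK.exists_bound_of_continuousOn ((h1 k i j).mono hKΩ)
  have hn1 : 0 ≤ ∑ i, ∑ j, |b0 i j| :=
    Finset.sum_nonneg fun _ _ => Finset.sum_nonneg fun _ _ => abs_nonneg _
  have hn2 : 0 ≤ ∑ k, ∑ i, ∑ j, |b1 k i j| := Finset.sum_nonneg fun _ _ =>
    Finset.sum_nonneg fun _ _ => Finset.sum_nonneg fun _ _ => abs_nonneg _
  refine ⟨1 + ∑ i, ∑ j, |b0 i j| + ∑ k, ∑ i, ∑ j, |b1 k i j|, by linarith, fun x hx =>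
    ⟨fun i j => ?_, fun k i j => ?_⟩⟩
  · have := hb0 i j x hx
    rw [Real.norm_eq_abs] at this
    have h2 := Finset.single_le_sum (f := fun j => |b0 i j|) (fun _ _ => abs_nonneg _)
      (Finset.mem_univ j)
    have h3 := Finset.single_le_sum (f := fun i => ∑ j, |b0 i j|)
      (fun _ _ => Finset.sum_nonneg fun _ _ => abs_nonneg _) (Finset.mem_univ i)
    have := le_abs_self (b0 i j)
    linarith
  · have := hb1 k i j x hx
    rw [Real.norm_eq_abs] at this
    have h2 := Finset.single_le_sum (f := fun j => |b1 k i j|) (fun _ _ => abs_nonneg _)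
      (Finset.mem_univ j)
    have h3 := Finset.single_le_sum (f := fun i => ∑ j, |b1 k i j|)
      (fun _ _ => Finset.sum_nonneg fun _ _ => abs_nonneg _) (Finset.mem_univ i)
    have h4 := Finset.single_le_sum (f := fun k => ∑ i, ∑ j, |b1 k i j|)
      (fun _ _ => Finset.sum_nonneg fun _ _ => Finset.sum_nonneg fun _ _ => abs_nonneg _)
      (Finset.mem_univ k)
    have := le_abs_self (b1 k i j)
    linarith

lemma sc1 {τ e y K Λ X : ℝ} {N : ℕ} (hτ : 1 ≤ τ) (he : 1 ≤ e) (hey : e ≤ y) (hK : 0 < K)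
    (hX : X = τ * y ^ (N + 1)) :
    (K * (τ ^ 3 * ((e ^ N) ^ 3 * e ^ 2)) + 1 / 2 * Λ ^ 2) * Real.exp (τ * e ^ N) ^ 2
      ≤ (K + Λ ^ 2) * (40320 * Real.exp (3 * X)) := by
  have hy : 1 ≤ y := he.trans hey
  have hyN : e ^ N ≤ y ^ (N + 1) :=
    (pow_le_pow_left₀ (by linarith) hey N).trans (pow_le_pow_right₀ hy (by omega))
  have hy1 : 1 ≤ y ^ (N + 1) := one_le_pow₀ hy
  have hτX : τ ≤ X := by rw [hX]; exact le_mul_of_one_le_right (by linarith) hy1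
  have hPX' : τ * e ^ N ≤ X := by rw [hX]; gcongr
  have heN : 1 ≤ e ^ N := one_le_pow₀ he
  have hPX : e ^ N ≤ X := le_trans (le_mul_of_one_le_left (by linarith) hτ) hPX'
  have heX : e ≤ X := by
    have h1 : y ≤ y ^ (N + 1) := le_self_pow₀ hy (by omega)
    have h2 : y ^ (N + 1) ≤ X := by rw [hX]; exact le_mul_of_one_le_left (by linarith) hτ
    linarith
  have hX1 : 1 ≤ X := hτ.trans hτX
  have h1 : τ ^ 3 * ((e ^ N) ^ 3 * e ^ 2) ≤ X ^ 8 := by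
    calc _ ≤ X ^ 3 * (X ^ 3 * X ^ 2) := by gcongr
      _ = _ := by ring
  have h2 : 1 ≤ X ^ 8 := one_le_pow₀ hX1
  have h3 : X ^ 8 ≤ 40320 * Real.exp X := by
    have := Real.pow_div_factorial_le_exp X (by linarith) 8
    rw [div_le_iff₀ (by positivity)] at this
    have hf : ((Nat.factorial 8 : ℕ) : ℝ) = 40320 := by norm_num [Nat.factorial]
    rw [hf] at this
    linarith
  have h4 : Real.exp (τ * e ^ N) ^ 2 ≤ Real.exp X ^ 2 := by gcongr
  have h5 : K * (τ ^ 3 * ((e ^ N) ^ 3 * e ^ 2)) + 1 / 2 * Λ ^ 2 ≤ (K + Λ ^ 2) * X ^ 8 := by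
    have a1 : K * (τ ^ 3 * ((e ^ N) ^ 3 * e ^ 2)) ≤ K * X ^ 8 := by gcongr
    have a2 : Λ ^ 2 * 1 ≤ Λ ^ 2 * X ^ 8 := by gcongr
    have a3 := sq_nonneg Λ
    linarith
  calc _ ≤ ((K + Λ ^ 2) * X ^ 8) * Real.exp X ^ 2 := by gcongr
    _ ≤ ((K + Λ ^ 2) * (40320 * Real.exp X)) * Real.exp X ^ 2 := by gcongr
    _ = (K + Λ ^ 2) * (40320 * Real.exp X ^ 3) := by ring
    _ = _ := by rw [← Real.exp_nat_mul]; norm_num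


set_option maxHeartbeats 1000000 in
/-- The pointwise Carleman inequality with cutoff. -/
lemma local_ptw {n : ℕ} (hn : n = 2 ∨ n = 3) {Ω : Set (Eu n)} (hΩ : IsOpen Ω)
    (A : Fin n → Fin n → Eu n → ℝ) (hA : ∀ i j, ContDiffOn ℝ 1 (A i j) Ω)
    (hsym : ∀ i j, ∀ x ∈ Ω, A i j x = A j i x) {lam Λ M R : ℝ} (hlam : 0 < lam)
    (hell : ∀ x ∈ Ω, ∀ ξ : Fin n → ℝ, lam * ∑ i, ξ i ^ 2 ≤ ∑ i, ∑ j, A i j x * ξ i * ξ j)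
    (hΛ : 0 < Λ) (hM : 0 < M) (hR : 0 < R) (hR1 : R ≤ 1 / 2) {Kc : Set (Eu n)} (hK : IsCompact Kc)
    (hKΩ : Kc ⊆ Ω) :
    ∃ N : ℕ, 1 ≤ N ∧ ∃ c > 0, ∃ K > 0, ∃ C2 > 0, ∃ τ0 ≥ 1, ∀ u, Adm A Ω Λ M u →
      ∀ x0, closedBall x0 R ⊆ Kc → ∀ r, 0 < r → r ≤ R / 4 → ∀ τ, τ0 ≤ τ →
      ∃ dv : Eu n → ℝ, Integrable dv ∧ ∫ x, dv x = 0 ∧ ∀ x,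
        c * Real.exp (2 * τ * ((8 / R ^ 2) ^ N)) * (ball x0 (R / 4) \ ball x0 r).indicator (En u) x
        ≤ K * Real.exp (3 * (τ * ((1 / r ^ 2) ^ (N + 1)))) * (ball x0 r).indicator (En u) x
          + C2 * Real.exp (2 * τ * ((4 / R ^ 2) ^ N)) * (closedBall x0 R).indicator (fun _ => 1) x
          + dv x := by
  obtain ⟨B, hB, hAB⟩ := coeff_bound hΩ A hA hK hKΩ
  obtain ⟨N, hN, c, hc, K, hK0, τ0, hτ0, hcar⟩ := carleman_pt hn hlam hB
  obtain ⟨χ, hχ, hχ1, hχ0, b, hb, hχb⟩ := exists_cutoff (n := n) hR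
  obtain ⟨Lb, hLb⟩ : ∃ Lb, Lb = b * (Λ * M) + 36 * (B * b * M) := ⟨_, rfl⟩
  have hLb0 : 0 < Lb := by rw [hLb]; positivity
  refine ⟨N, hN, c, hc, (K + Λ ^ 2) * 40320, by positivity, Lb ^ 2, by positivity,
    max τ0 (Λ ^ 2 / (2 * c)), le_max_of_le_left hτ0, ?_⟩
  intro u hu x0 hx0 r hr hrR τ hτ
  have hτ1 : τ0 ≤ τ := (le_max_left _ _).trans hτ
  have hτ2 : Λ ^ 2 ≤ 2 * c * τ := by
    have := (le_max_right _ _).trans hτ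
    rw [div_le_iff₀ (by positivity)] at this
    linarith
  have hτ3 : 1 ≤ τ := hτ0.trans hτ1
  obtain ⟨w, hw⟩ : ∃ w : Eu n → ℝ, w = fun y => χ (y - x0) * u y := ⟨_, rfl⟩
  have hχt : ContDiff ℝ 2 (fun y => χ (y - x0)) := hχ.comp (contDiff_id.sub contDiff_const)
  have hwc : ContDiffOn ℝ 2 w Ω := by rw [hw]; exact hχt.contDiffOn.mul hu.c2
  have htend : ∀ x : Eu n, Filter.Tendsto (fun y => y - x0) (nhds x) (nhds (x - x0)) := fun x =>
    (continuous_id.sub continuous_const).continuousAt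
  have hw0 : ∀ x, 3 / 4 * R < dist x x0 → w =ᶠ[nhds x] fun _ => 0 := fun x hx => by
    rw [dist_eq_norm] at hx
    filter_upwards [(htend x).eventually (hχ0 _ hx)] with y hy
    rw [hw]; simp only [hy, zero_mul]
  have hw1 : ∀ x, dist x x0 < R / 2 → w =ᶠ[nhds x] u := fun x hx => by
    rw [dist_eq_norm] at hx
    filter_upwards [(htend x).eventually (hχ1 _ hx)] with y hy
    rw [hw]; simp only [hy, one_mul]
  have hsub : closedBall x0 (3 / 4 * R) ⊆ Ω :=
    (closedBall_subset_closedBall (by linarith)).trans (hx0.trans hKΩ)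
  obtain ⟨hd1, hd2, hd3⟩ := cdiv_integral (τ := τ) hΩ A hA w hwc x0 N hr hsub hw0
  refine ⟨fun x => -τ * cdiv τ N A x0 r w x, hd1.const_mul _, by
    rw [integral_const_mul, hd2, mul_zero], fun x => ?_⟩
  beta_reduce
  have hEn := En_nonneg u x
  have hind1 : 0 ≤ (ball x0 r).indicator (En u) x := indicator_nonneg (fun x _ => En_nonneg u x) x
  have hind2 : 0 ≤ (closedBall x0 R).indicator (fun _ => (1 : ℝ)) x :=
    indicator_nonneg (fun x _ => by norm_num) x
  by_cases hxR : dist x x0 ≤ 3 / 4 * R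
  swap
  · have h1 : x ∉ ball x0 (R / 4) \ ball x0 r := fun h => by
      have := h.1
      rw [mem_ball] at this; linarith
    rw [indicator_of_notMem h1, hd3 x (not_le.1 hxR), mul_zero, mul_zero, add_zero]
    positivity
  have hxK : x ∈ Kc := hx0 (by rw [mem_closedBall]; linarith)
  have hxΩ : x ∈ Ω := hKΩ hxK
  have hΩn : Ω ∈ nhds x := hΩ.mem_nhds hxΩ
  have hin : (closedBall x0 R).indicator (fun _ => (1 : ℝ)) x = 1 :=
    indicator_of_mem (by rw [mem_closedBall]; linarith) _
  have hD : 0 ≤ dist x x0 := dist_nonneg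
  have hdr : 0 < dist x x0 ^ 2 + r ^ 2 := by positivity
  have he1 : 1 ≤ wE x0 r x := by
    rw [wE_eq]
    refine (one_le_inv₀ hdr).2 ?_
    nlinarith
  have hAd : ∀ i j, DifferentiableAt ℝ (A i j) x := fun i j =>
    ((hA i j).contDiffAt hΩn).differentiableAt (by norm_num)
  obtain ⟨ha, hbb⟩ := hcar A w x x0 r τ hr hAd (hAB x hxK).1 (hAB x hxK).2 (fun i j => hsym i j x hxΩ)
    (hell x hxΩ) (hwc.contDiffAt hΩn) he1 hτ1
  rw [dist_sq_sum] at ha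
  have hexp2 : ∀ t : ℝ, Real.exp t ^ 2 = Real.exp (2 * t) := fun t => by
    rw [← Real.exp_nat_mul]; norm_num
  by_cases hxr : dist x x0 < r
  · -- inner ball
    have h1 : x ∉ ball x0 (R / 4) \ ball x0 r := fun h => h.2 hxr
    have hwu := hw1 x (by linarith)
    have hLw : Lop A w x = Lop A u x := Lop_germ A hwu
    have hpw : ∀ i, pd i w x = pd i u x := fun i => (pd_germ hwu i).self_of_nhds
    rw [hLw, hwu.self_of_nhds] at hbb
    simp only [hpw] at hbb
    rw [← En_eq] at hbb
    rw [indicator_of_notMem h1, indicator_of_mem (show x ∈ ball x0 r from hxr), hin, mul_zero]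
    have hL2 : Lop A u x ^ 2 ≤ Λ ^ 2 * En u x := by
      have h2 : Lop A u x ^ 2 ≤ (Λ * |u x|) ^ 2 := by
        rw [← sq_abs]; gcongr; exact hu.hL x hxΩ
      rw [mul_pow, sq_abs] at h2
      refine h2.trans ?_
      gcongr
      unfold En; nlinarith [sq_nonneg ‖fderiv ℝ u x‖]
    have hey : wE x0 r x ≤ 1 / r ^ 2 := by
      rw [wE_eq, one_div]
      exact inv_anti₀ (by positivity) (by nlinarith)
    have hs := sc1 (Λ := Λ) (N := N) hτ3 he1 hey hK0 rfl
    have hs2 := mul_le_mul_of_nonneg_right hs hEn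
    have h3 : 1 / 2 * Real.exp (τ * wE x0 r x ^ N) ^ 2 * Lop A u x ^ 2 ≤
        1 / 2 * Real.exp (τ * wE x0 r x ^ N) ^ 2 * (Λ ^ 2 * En u x) := by gcongr
    have h4 : 0 < Lb ^ 2 * Real.exp (2 * τ * ((4 / R ^ 2) ^ N)) * 1 := by positivity
    linarith
  · push Not at hxr
    have ha := ha (by gcongr)
    have h0 : (ball x0 r).indicator (En u) x = 0 := indicator_of_notMem (by simpa using hxr) _
    rw [h0, hin, mul_zero, zero_add, mul_one]
    have h4 : 0 < Lb ^ 2 * Real.exp (2 * τ * ((4 / R ^ 2) ^ N)) := by positivity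
    by_cases hx2 : dist x x0 < R / 2
    · have hwu := hw1 x hx2
      have hLw : Lop A w x = Lop A u x := Lop_germ A hwu
      have hpw : ∀ i, pd i w x = pd i u x := fun i => (pd_germ hwu i).self_of_nhds
      rw [hLw, hwu.self_of_nhds] at ha
      simp only [hpw] at ha
      rw [← En_eq] at ha
      obtain ⟨E2, hE2⟩ : ∃ E2, E2 = Real.exp (τ * wE x0 r x ^ N) ^ 2 := ⟨_, rfl⟩
      have hE20 : 0 < E2 := by rw [hE2]; positivity
      rw [← hE2] at ha
      have hL2 : Lop A u x ^ 2 ≤ 2 * c * τ * u x ^ 2 := by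
        have h2 : Lop A u x ^ 2 ≤ (Λ * |u x|) ^ 2 := by
          rw [← sq_abs]; gcongr; exact hu.hL x hxΩ
        rw [mul_pow, sq_abs] at h2
        refine h2.trans ?_
        gcongr
      have h3 : 1 / 2 * E2 * Lop A u x ^ 2 ≤ 1 / 2 * E2 * (2 * c * τ * u x ^ 2) := by gcongr
      have h5 : c * (E2 * En u x) ≤ -τ * cdiv τ N A x0 r w x := by linarith
      by_cases hx4 : x ∈ ball x0 (R / 4) \ ball x0 r
      · rw [indicator_of_mem hx4]
        have h6 : Real.exp (2 * τ * (8 / R ^ 2) ^ N) ≤ E2 := by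
          rw [hE2, hexp2, mul_assoc]
          have h7 : 8 / R ^ 2 ≤ wE x0 r x := by
            have h8 : dist x x0 < R / 4 := hx4.1
            rw [wE_eq, ← one_div, div_le_div_iff₀ (by positivity) hdr]
            nlinarith
          gcongr
        have h7 : c * Real.exp (2 * τ * (8 / R ^ 2) ^ N) * En u x ≤ c * E2 * En u x := by gcongr
        linarith
      · rw [indicator_of_notMem hx4, mul_zero]
        have : 0 ≤ c * (E2 * En u x) := by positivity
        linarith
    · push Not at hx2
      have hx4 : x ∉ ball x0 (R / 4) \ ball x0 r := fun h => by
        have := h.1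
        rw [mem_ball] at this; linarith
      rw [indicator_of_notMem hx4, mul_zero]
      have hz : ‖x - x0‖ ≤ R := by rw [← dist_eq_norm]; linarith
      obtain ⟨k0, k1, k2⟩ := hχb (x - x0) hz
      have hLw : |Lop A w x| ≤ Lb := by
        rw [hw, hLb]
        refine Lop_mul_bound hn A (fun y => χ (y - x0)) u x hb hB hM hχt.contDiffAt
          (hu.c2.contDiffAt hΩn) hAd (hAB x hxK).1 (hAB x hxK).2 k0 (fun j => ?_) (fun i j => ?_)
          (hu.b0 x hxΩ) (fun j => ?_) ?_
        · rw [pd_translate]; exact k1 j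
        · have : pd j (fun y => χ (y - x0)) = fun y => pd j χ (y - x0) := by
            funext y; exact pd_translate _ _ _ _
          rw [this, pd_translate]; exact k2 i j
        · refine le_trans ?_ (hu.b1 x hxΩ)
          have := (fderiv ℝ u x).le_opNorm (EuclideanSpace.single j 1)
          simpa [pd] using this
        · refine (hu.hL x hxΩ).trans ?_
          have := hu.b0 x hxΩ
          gcongr
      have hL2 : Lop A w x ^ 2 ≤ Lb ^ 2 := by rw [← sq_abs]; gcongr
      have h6 : Real.exp (τ * wE x0 r x ^ N) ^ 2 ≤ Real.exp (2 * τ * (4 / R ^ 2) ^ N) := by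
        rw [hexp2, mul_assoc]
        have h7 : wE x0 r x ≤ 4 / R ^ 2 := by
          rw [wE_eq, ← one_div, div_le_div_iff₀ hdr (by positivity)]
          nlinarith
        have h8 : 0 ≤ wE x0 r x := by linarith
        gcongr
      have h9 : Real.exp (τ * wE x0 r x ^ N) ^ 2 * Lop A w x ^ 2 ≤
        Real.exp (2 * τ * (4 / R ^ 2) ^ N) * Lb ^ 2 := by gcongr
      have h10 : 0 ≤ c * (Real.exp (τ * wE x0 r x ^ N) ^ 2 * (w x ^ 2 + ∑ i, pd i w x ^ 2)
          + τ * (Real.exp (τ * wE x0 r x ^ N) ^ 2 * w x ^ 2)) := by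
        have : 0 ≤ ∑ i, pd i w x ^ 2 := Finset.sum_nonneg fun i _ => sq_nonneg _
        positivity
      linarith


lemma local_prop {n : ℕ} (hn : n = 2 ∨ n = 3) {Ω : Set (Eu n)} (hΩ : IsOpen Ω)
    (A : Fin n → Fin n → Eu n → ℝ) (hA : ∀ i j, ContDiffOn ℝ 1 (A i j) Ω)
    (hsym : ∀ i j, ∀ x ∈ Ω, A i j x = A j i x) {lam Λ M R : ℝ} (hlam : 0 < lam)
    (hell : ∀ x ∈ Ω, ∀ ξ : Fin n → ℝ, lam * ∑ i, ξ i ^ 2 ≤ ∑ i, ∑ j, A i j x * ξ i * ξ j)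
    (hΛ : 0 < Λ) (hM : 0 < M) (hR : 0 < R) (hR1 : R ≤ 1 / 2) {Kc : Set (Eu n)} (hK : IsCompact Kc)
    (hKΩ : Kc ⊆ Ω) :
    ∃ N : ℕ, ∃ C > 0, ∃ g0 > 0, ∀ u, Adm A Ω Λ M u →
      ∀ x0, closedBall x0 R ⊆ Kc → ∀ r, 0 < r → r ≤ R / 4 → ∀ τ, C ≤ τ →
      ∫ x in ball x0 (R / 4), En u x ≤ Real.exp (C * τ * (1 / r) ^ N) * (∫ x in ball x0 r, En u x)
        + C * Real.exp (-(g0 * τ)) := by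
  obtain ⟨N, hN, c, hc, K, hK0, C2, hC2, τ0, hτ0, hmain⟩ :=
    local_ptw hn hΩ A hA hsym hlam hell hΛ hM hR hR1 hK hKΩ
  obtain ⟨V, hV⟩ : ∃ V, V = (volume (closedBall (0 : Eu n) R)).toReal := ⟨_, rfl⟩
  have hV0 : 0 ≤ V := hV ▸ ENNReal.toReal_nonneg
  obtain ⟨g, hg⟩ : ∃ g, g = 2 * ((8 / R ^ 2) ^ N - (4 / R ^ 2) ^ N) := ⟨_, rfl⟩
  have hg0 : 0 < g := by
    have : (4 / R ^ 2) ^ N < (8 / R ^ 2) ^ N := by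
      apply pow_lt_pow_left₀ _ (by positivity) (by omega)
      gcongr; norm_num
    linarith
  obtain ⟨Ka, hKa⟩ : ∃ Ka, Ka = 1 + K / c := ⟨_, rfl⟩
  have hKa0 : 0 < Ka := by rw [hKa]; positivity
  have hq : 0 ≤ C2 * V / c := by positivity
  refine ⟨2 * (N + 1), τ0 + (3 + Ka) + C2 * V / c, by positivity, g, hg0, ?_⟩
  intro u hu x0 hx0 r hr hrR τ hτ
  obtain ⟨dv, hdv, hdv0, hpt⟩ := hmain u hu x0 hx0 r hr hrR τ (by linarith)
  obtain ⟨X, hX⟩ : ∃ X, X = τ * ((1 / r ^ 2) ^ (N + 1)) := ⟨_, rfl⟩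
  rw [← hX] at hpt
  have hτ1 : 1 ≤ τ := by linarith
  have hX1 : 1 ≤ X := by
    have h1 : 1 ≤ 1 / r ^ 2 := by
      rw [le_div_iff₀ (by positivity)]
      nlinarith
    rw [hX]
    exact one_le_mul_of_one_le_of_one_le hτ1 (one_le_pow₀ h1)
  have hXr : (1 / r) ^ (2 * (N + 1)) * τ = X := by
    rw [hX, pow_mul, div_pow, one_pow]; ring
  have hballΩ : closedBall x0 R ⊆ Ω := hx0.trans hKΩ
  have hi4 : IntegrableOn (En u) (ball x0 (R / 4)) :=
    En_intOn hΩ hu.c2 ((closedBall_subset_closedBall (by linarith)).trans hballΩ)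
  have hsub : ball x0 r ⊆ ball x0 (R / 4) := ball_subset_ball hrR
  have hir : IntegrableOn (En u) (ball x0 r) := hi4.mono_set hsub
  have hia : IntegrableOn (En u) (ball x0 (R / 4) \ ball x0 r) := hi4.mono_set sdiff_subset
  have hma : MeasurableSet (ball x0 (R / 4) \ ball x0 r) := measurableSet_ball.diff measurableSet_ball
  have hfin : volume (closedBall x0 R) ≠ ⊤ := (isCompact_closedBall x0 R).measure_lt_top.ne
  have i1 : Integrable ((ball x0 (R / 4) \ ball x0 r).indicator (En u)) := hia.integrable_indicator hma
  have i2 : Integrable ((ball x0 r).indicator (En u)) := hir.integrable_indicator measurableSet_ball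
  have i3 : Integrable ((closedBall x0 R).indicator (fun _ => (1 : ℝ))) :=
    (integrableOn_const hfin).integrable_indicator measurableSet_closedBall
  have hInt := integral_mono (i1.const_mul (c * Real.exp (2 * τ * ((8 / R ^ 2) ^ N))))
    (((i2.const_mul (K * Real.exp (3 * X))).add
      (i3.const_mul (C2 * Real.exp (2 * τ * ((4 / R ^ 2) ^ N))))).add hdv) hpt
  simp only [Pi.add_apply] at hInt
  have j23 : Integrable (fun x => K * Real.exp (3 * X) * (ball x0 r).indicator (En u) x
      + C2 * Real.exp (2 * τ * ((4 / R ^ 2) ^ N)) * (closedBall x0 R).indicator (fun _ => 1) x) :=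
    (i2.const_mul _).add (i3.const_mul _)
  rw [integral_add j23 hdv,
    integral_add (i2.const_mul _) (i3.const_mul _), integral_const_mul, integral_const_mul,
    integral_const_mul, hdv0, integral_indicator hma, integral_indicator measurableSet_ball,
    integral_indicator measurableSet_closedBall, setIntegral_const, add_zero] at hInt
  have hvol : volume.real (closedBall x0 R) = V := by
    rw [hV, Measure.real, Measure.addHaar_closedBall_center]
  rw [hvol, smul_eq_mul, mul_one] at hInt
  obtain ⟨Ia, hIa⟩ : ∃ I, I = ∫ x in ball x0 (R / 4) \ ball x0 r, En u x := ⟨_, rfl⟩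
  obtain ⟨Ir, hIr⟩ : ∃ I, I = ∫ x in ball x0 r, En u x := ⟨_, rfl⟩
  have hIr0 : 0 ≤ Ir := hIr ▸ setIntegral_nonneg measurableSet_ball fun x _ => En_nonneg u x
  have hsplit : ∫ x in ball x0 (R / 4), En u x = Ir + Ia := by
    rw [hIa, setIntegral_sdiff measurableSet_ball hi4 hsub, ← hIr]; ring
  rw [← hIa, ← hIr] at hInt
  rw [hsplit, ← hIr]
  -- divide
  obtain ⟨E1, hE1⟩ : ∃ E1, E1 = Real.exp (2 * τ * ((8 / R ^ 2) ^ N)) := ⟨_, rfl⟩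
  have hE11 : 1 ≤ E1 := by
    rw [hE1]; apply Real.one_le_exp; positivity
  have hE2 : Real.exp (2 * τ * ((4 / R ^ 2) ^ N)) = E1 * Real.exp (-(g * τ)) := by
    rw [hE1, ← Real.exp_add, hg]; congr 1; ring
  rw [← hE1, hE2] at hInt
  have hE1' : 0 < E1 := by linarith
  have h1 : Ia ≤ K / c * Real.exp (3 * X) * Ir + C2 * V / c * Real.exp (-(g * τ)) := by
    have h2 : K * Real.exp (3 * X) * Ir ≤ E1 * (K * Real.exp (3 * X) * Ir) :=
      le_mul_of_one_le_left (by positivity) hE11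
    have h3 : E1 * (c * Ia) ≤ E1 * (K * Real.exp (3 * X) * Ir
        + C2 * V * Real.exp (-(g * τ))) := by linarith
    have h4 := le_of_mul_le_mul_left h3 hE1'
    have h5 : Ia ≤ (K * Real.exp (3 * X) * Ir + C2 * V * Real.exp (-(g * τ))) / c := by
      rw [le_div_iff₀ hc]; linarith
    refine h5.trans (le_of_eq ?_)
    field_simp
  have h6 : 1 ≤ Real.exp (3 * X) := Real.one_le_exp (by linarith)
  have h7 : Ir ≤ Real.exp (3 * X) * Ir := le_mul_of_one_le_left hIr0 h6
  have h8 : Ka * Real.exp (3 * X) ≤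
      Real.exp ((τ0 + (3 + Ka) + C2 * V / c) * τ * (1 / r) ^ (2 * (N + 1))) := by
    have a1 : Ka ≤ Real.exp (Ka * X) := by
      have := Real.add_one_le_exp (Ka * X)
      have : Ka ≤ Ka * X := le_mul_of_one_le_right hKa0.le hX1
      linarith
    calc Ka * Real.exp (3 * X) ≤ Real.exp (Ka * X) * Real.exp (3 * X) := by gcongr
      _ = Real.exp ((3 + Ka) * X) := by rw [← Real.exp_add]; congr 1; ring
      _ ≤ Real.exp ((τ0 + (3 + Ka) + C2 * V / c) * X) := by
        have b1 : 0 ≤ C2 * V / c := by positivity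
        exact Real.exp_le_exp.2 (mul_le_mul_of_nonneg_right (by linarith) (by linarith))
      _ = _ := by rw [← hXr]; congr 1; ring
  have h9 : Ka * Real.exp (3 * X) * Ir ≤
      Real.exp ((τ0 + (3 + Ka) + C2 * V / c) * τ * (1 / r) ^ (2 * (N + 1))) * Ir := by gcongr
  have h10 : C2 * V / c * Real.exp (-(g * τ)) ≤
      (τ0 + (3 + Ka) + C2 * V / c) * Real.exp (-(g * τ)) := by
    gcongr; linarith
  have h11 : Ka * Real.exp (3 * X) * Ir = Real.exp (3 * X) * Ir + K / c * Real.exp (3 * X) * Ir := by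
    rw [hKa]; ring
  linarith


lemma Lop_cont {n : ℕ} {Ω : Set (Eu n)} (hΩ : IsOpen Ω)
    (A : Fin n → Fin n → Eu n → ℝ) (hA : ∀ i j, ContDiffOn ℝ 1 (A i j) Ω) {u : Eu n → ℝ}
    (hu : ContDiffOn ℝ 2 u Ω) : ContinuousOn (Lop A u) Ω := by
  refine continuousOn_finsetSum _ fun i _ => continuousOn_finsetSum _ fun j _ => ?_
  have h1 : ContDiffOn ℝ 1 (fun y => A i j y * pd j u y) Ω := fun x hx =>
    (((hA i j).contDiffAt (hΩ.mem_nhds hx)).mul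
      (pd_c1 (hu.contDiffAt (hΩ.mem_nhds hx)) j)).contDiffWithinAt
  exact (h1.continuousOn_fderiv_of_isOpen hΩ (by norm_num)).clm_apply continuousOn_const

lemma Lop_le {n : ℕ} {Ω : Set (Eu n)} (hΩ : IsOpen Ω)
    (A : Fin n → Fin n → Eu n → ℝ) (hA : ∀ i j, ContDiffOn ℝ 1 (A i j) Ω) {q u : Eu n → ℝ} {Λ : ℝ}
    (hu : ContDiffOn ℝ 2 u Ω) (hsol : IsSolution A q u Ω)
    (hq : ∀ᵐ x ∂(volume.restrict Ω), |q x| ≤ Λ) : ∀ x ∈ Ω, |Lop A u x| ≤ Λ * |u x| := by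
  have hae : ∀ᵐ x ∂(volume : Measure (Eu n)), x ∈ Ω → |Lop A u x| ≤ Λ * |u x| := by
    rw [ae_restrict_iff' hΩ.measurableSet] at hq
    filter_upwards [hq] with x hx hxΩ
    have h1 : Lop A u x = -(q x * u x) := by
      have := hsol x hxΩ
      unfold Lop; linarith
    rw [h1, abs_neg, abs_mul]
    gcongr
    exact hx hxΩ
  by_contra! hcon
  obtain ⟨x, hx, hlt⟩ := hcon
  have hc : ContinuousOn (fun y => |Lop A u y| - Λ * |u y|) Ω :=
    (Lop_cont hΩ A hA hu).abs.sub (continuousOn_const.mul hu.continuousOn.abs)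
  have hev : ∀ᶠ y in nhds x, 0 < |Lop A u y| - Λ * |u y| :=
    (hc.continuousAt (hΩ.mem_nhds hx)).eventually (lt_mem_nhds (by linarith))
  have hev2 : {y | y ∈ Ω ∧ 0 < |Lop A u y| - Λ * |u y|} ∈ nhds x :=
    Filter.inter_mem (hΩ.mem_nhds hx) hev
  obtain ⟨y, hy, hy2⟩ := (Measure.dense_of_ae hae).inter_nhds_nonempty hev2
  · have := hy hy2.1
    have := hy2.2
    linarith

lemma I_mono {n : ℕ} {Ω : Set (Eu n)} (hΩ : IsOpen Ω) {u : Eu n → ℝ} (hu : ContDiffOn ℝ 2 u Ω)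
    {x y : Eu n} {a b : ℝ} (hb : closedBall y b ⊆ Ω) (h : ball x a ⊆ ball y b) :
    ∫ z in ball x a, En u z ≤ ∫ z in ball y b, En u z :=
  setIntegral_mono_set (En_intOn hΩ hu hb) (Filter.Eventually.of_forall fun z => En_nonneg u z)
    h.eventuallyLE

lemma I_nonneg {n : ℕ} (u : Eu n → ℝ) (D : Set (Eu n)) : 0 ≤ ∫ z in D, En u z :=
  integral_nonneg fun z => En_nonneg u z

lemma qual {n : ℕ} (hn : n = 2 ∨ n = 3) {Ω : Set (Eu n)} (hΩ : IsOpen Ω) (hΩc : IsPreconnected Ω)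
    (A : Fin n → Fin n → Eu n → ℝ) (hA : ∀ i j, ContDiffOn ℝ 1 (A i j) Ω)
    (hsym : ∀ i j, ∀ x ∈ Ω, A i j x = A j i x) {lam Λ M : ℝ} (hlam : 0 < lam)
    (hell : ∀ x ∈ Ω, ∀ ξ : Fin n → ℝ, lam * ∑ i, ξ i ^ 2 ≤ ∑ i, ∑ j, A i j x * ξ i * ξ j)
    (hΛ : 0 < Λ) (hM : 0 < M) {K0 : Set (Eu n)} (hK : IsCompact K0) {ρ : ℝ} (hρ : 0 < ρ)
    (hKΩ : ∀ x ∈ K0, closedBall x ρ ⊆ Ω) {y0 : Eu n} {β η : ℝ} (hβ : 0 < β)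
    (hy0 : closedBall y0 β ⊆ Ω) (hη : 0 < η) :
    ∃ δ > 0, ∀ u, Adm A Ω Λ M u → (∀ x ∈ ball y0 β, η ≤ |u x|) →
      ∀ x ∈ K0, δ ≤ ∫ z in ball x ρ, En u z := by
  by_contra! hcon
  have hc : ∀ k : ℕ, ∃ u, Adm A Ω Λ M u ∧ (∀ x ∈ ball y0 β, η ≤ |u x|) ∧
      ∃ x ∈ K0, ∫ z in ball x ρ, En u z < 1 / ((k : ℝ) + 1) := fun k =>
    hcon (1 / ((k : ℝ) + 1)) (by positivity)
  choose u hu huη x hxK hxI using hc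
  obtain ⟨xi, hxi, φ, hφ, hlim⟩ := hK.tendsto_subseq hxK
  obtain ⟨Z, hZ⟩ : ∃ Z : Set (Eu n), Z = {p | ∃ s > 0, closedBall p s ⊆ Ω ∧
    Filter.Tendsto (fun k => ∫ z in ball p s, En (u (φ k)) z) Filter.atTop (nhds 0)} := ⟨_, rfl⟩
  have hZmem : ∀ p, ∀ s > 0, closedBall p s ⊆ Ω → (∀ ε > 0, ∀ᶠ k in Filter.atTop,
      ∫ z in ball p s, En (u (φ k)) z < ε) → p ∈ Z := by
    intro p s hs hps h
    rw [hZ]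
    refine ⟨s, hs, hps, ?_⟩
    rw [Metric.tendsto_nhds]
    intro ε hε
    filter_upwards [h ε hε] with k hk
    rw [Real.dist_eq, sub_zero, abs_of_nonneg (I_nonneg _ _)]; exact hk
  have hZd : ∀ p ∈ Z, ∃ s > 0, closedBall p s ⊆ Ω ∧ ∀ ε > 0, ∀ᶠ k in Filter.atTop,
      ∫ z in ball p s, En (u (φ k)) z < ε := by
    intro p hp
    rw [hZ] at hp
    obtain ⟨s, hs, hps, ht⟩ := hp
    exact ⟨s, hs, hps, fun ε hε => ht.eventually (gt_mem_nhds hε)⟩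
  have hZopen : IsOpen Z := by
    rw [Metric.isOpen_iff]
    intro p hp
    obtain ⟨s, hs, hps, h⟩ := hZd p hp
    refine ⟨s / 2, by positivity, fun y hy => ?_⟩
    rw [mem_ball] at hy
    have hsub : closedBall y (s / 2) ⊆ closedBall p s :=
      closedBall_subset_closedBall' (by linarith)
    refine hZmem y (s / 2) (by positivity) (hsub.trans hps) fun ε hε => ?_
    filter_upwards [h ε hε] with k hk
    refine lt_of_le_of_lt (I_mono hΩ (hu _).c2 hps ?_) hk
    exact ball_subset_ball' (by linarith)
  have hxiZ : xi ∈ Z := by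
    refine hZmem xi (ρ / 2) (by positivity)
      ((closedBall_subset_closedBall (by linarith)).trans (hKΩ xi hxi)) fun ε hε => ?_
    have h1 : ∀ᶠ k in Filter.atTop, dist (x (φ k)) xi < ρ / 2 :=
      (Metric.tendsto_nhds.1 hlim) (ρ / 2) (by positivity)
    have h2 : ∀ᶠ k in Filter.atTop, 1 / ((φ k : ℝ) + 1) < ε :=
      (tendsto_one_div_add_atTop_nhds_zero_nat.comp hφ.tendsto_atTop).eventually (gt_mem_nhds hε)
    filter_upwards [h1, h2] with k hk1 hk2
    refine lt_of_le_of_lt (I_mono hΩ (hu _).c2 (hKΩ _ (hxK (φ k))) ?_) ((hxI (φ k)).trans hk2)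
    refine ball_subset_ball' ?_
    rw [dist_comm]; linarith
  have hsubZ : Ω ⊆ Z := by
    refine hΩc.subset_of_closure_inter_subset hZopen ⟨xi, hKΩ xi hxi (mem_closedBall_self hρ.le),
      hxiZ⟩ ?_
    rintro p ⟨hpZ, hpΩ⟩
    obtain ⟨s, hs, hps⟩ := Metric.isOpen_iff.1 hΩ p hpΩ
    obtain ⟨R, hRd⟩ : ∃ R, R = min (1 / 2) (s / 4) := ⟨_, rfl⟩
    have hR : 0 < R := by rw [hRd]; positivity
    have hR1 : R ≤ 1 / 2 := hRd ▸ min_le_left _ _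
    have hR2 : R ≤ s / 4 := hRd ▸ min_le_right _ _
    have hKc : closedBall p (2 * R) ⊆ Ω := (closedBall_subset_ball (by linarith)).trans hps
    obtain ⟨N, C, hC, g0, hg0, hloc⟩ := local_prop hn hΩ A hA hsym hlam hell hΛ hM hR hR1
      (isCompact_closedBall p (2 * R)) hKc
    obtain ⟨y, hyZ, hyp⟩ := Metric.mem_closure_iff.1 hpZ (R / 8) (by positivity)
    obtain ⟨s', hs', hys, h⟩ := hZd y hyZ
    have hyK : closedBall y R ⊆ closedBall p (2 * R) :=
      closedBall_subset_closedBall' (by rw [dist_comm]; linarith)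
    refine hZmem p (R / 8) (by positivity)
      ((closedBall_subset_closedBall (by linarith)).trans hKc) fun ε hε => ?_
    obtain ⟨r, hr⟩ : ∃ r, r = min s' (R / 4) := ⟨_, rfl⟩
    have hr0 : 0 < r := by rw [hr]; positivity
    have hr1 : r ≤ s' := hr ▸ min_le_left _ _
    have hr2 : r ≤ R / 4 := hr ▸ min_le_right _ _
    have hτ : ∃ τ, C ≤ τ ∧ C * Real.exp (-(g0 * τ)) < ε / 2 := by
      have ht : Filter.Tendsto (fun τ => C * Real.exp (-(g0 * τ))) Filter.atTop (nhds (C * 0)) := by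
        refine Filter.Tendsto.const_mul C (Real.tendsto_exp_neg_atTop_nhds_zero.comp ?_)
        exact Filter.tendsto_id.const_mul_atTop hg0
      rw [mul_zero] at ht
      obtain ⟨τ, h1, h2⟩ := ((Filter.eventually_ge_atTop C).and
        (ht.eventually (gt_mem_nhds (half_pos hε)))).exists
      exact ⟨τ, h1, h2⟩
    obtain ⟨τ, hτC, hτε⟩ := hτ
    obtain ⟨E, hE⟩ : ∃ E, E = Real.exp (C * τ * (1 / r) ^ N) := ⟨_, rfl⟩
    have hE0 : 0 < E := hE ▸ Real.exp_pos _
    filter_upwards [h (ε / (2 * E)) (by positivity)] with k hk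
    have h1 := hloc (u (φ k)) (hu _) y hyK r hr0 hr2 τ hτC
    rw [← hE] at h1
    have h2 : ∫ z in ball p (R / 8), En (u (φ k)) z ≤ ∫ z in ball y (R / 4), En (u (φ k)) z :=
      I_mono hΩ (hu _).c2 ((closedBall_subset_closedBall (by linarith)).trans (hyK.trans hKc))
        (ball_subset_ball' (by linarith))
    have h3 : ∫ z in ball y r, En (u (φ k)) z ≤ ∫ z in ball y s', En (u (φ k)) z :=
      I_mono hΩ (hu _).c2 hys (ball_subset_ball hr1)
    have h4 : E * (∫ z in ball y r, En (u (φ k)) z) < E * (ε / (2 * E)) := by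
      gcongr; linarith
    have h5 : E * (ε / (2 * E)) = ε / 2 := by field_simp
    linarith
  have hy0Z : y0 ∈ Z := hsubZ (hy0 (mem_closedBall_self hβ.le))
  obtain ⟨s, hs, hps, h⟩ := hZd y0 hy0Z
  obtain ⟨t, ht⟩ : ∃ t, t = min s β := ⟨_, rfl⟩
  have ht0 : 0 < t := by rw [ht]; positivity
  have hvol : 0 < volume.real (ball y0 t) :=
    ENNReal.toReal_pos (measure_ball_pos _ _ ht0).ne' measure_ball_lt_top.ne
  obtain ⟨k, hk⟩ := (h (η ^ 2 * volume.real (ball y0 t)) (by positivity)).exists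
  have h1 : ∫ z in ball y0 t, En (u (φ k)) z ≤ ∫ z in ball y0 s, En (u (φ k)) z :=
    I_mono hΩ (hu _).c2 hps (ball_subset_ball (ht ▸ min_le_left _ _))
  have h2 : η ^ 2 * volume.real (ball y0 t) ≤ ∫ z in ball y0 t, En (u (φ k)) z := by
    refine setIntegral_ge_of_const_le_real measurableSet_ball measure_ball_lt_top.ne (fun z hz => ?_)
      ((En_intOn hΩ (hu _).c2 hps).mono_set (ball_subset_ball (ht ▸ min_le_left _ _)))
    have h3 := huη (φ k) z (ball_subset_ball (ht ▸ min_le_right _ _) hz)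
    have h4 : η ^ 2 ≤ |u (φ k) z| ^ 2 := by gcongr
    rw [sq_abs] at h4
    unfold En
    have := sq_nonneg ‖fderiv ℝ (u (φ k)) z‖
    linarith
  linarith


lemma num_lem {C1 C2 : ℝ} (hC1 : 0 < C1) (hC2 : 0 ≤ C2) (N : ℕ) :
    ∃ c0 > 0, ∀ c, c0 ≤ c → ∀ r J : ℝ, 0 < r → C1 * Real.exp (-(C2 * (1 / r) ^ N)) ≤ J →
      Real.exp (-(c * Real.exp (c / r))) ≤ J ^ (1 / 2 : ℝ) := by
  refine ⟨1 + |Real.log C1| + C2 * N.factorial, by positivity, fun c hc r J hr hJ => ?_⟩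
  have hf0 : 0 ≤ C2 * N.factorial := by positivity
  have hl0 := abs_nonneg (Real.log C1)
  have hc1 : 1 ≤ c := by linarith
  have hr' : 0 < 1 / r := by positivity
  have h1 : (1 / r) ^ N ≤ N.factorial * Real.exp (1 / r) := by
    have := Real.pow_div_factorial_le_exp (1 / r) hr'.le N
    rw [div_le_iff₀ (by positivity)] at this
    linarith
  have h2 : Real.exp (1 / r) ≤ Real.exp (c / r) := by gcongr
  have h3 : 1 ≤ Real.exp (1 / r) := Real.one_le_exp hr'.le
  have h4 : -Real.log C1 + C2 * (1 / r) ^ N ≤ c * Real.exp (c / r) := by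
    calc -Real.log C1 + C2 * (1 / r) ^ N
        ≤ |Real.log C1| * Real.exp (1 / r) + C2 * (N.factorial * Real.exp (1 / r)) := by
          have a1 := neg_le_abs (Real.log C1)
          have a2 : |Real.log C1| ≤ |Real.log C1| * Real.exp (1 / r) :=
            le_mul_of_one_le_right hl0 h3
          have a3 := mul_le_mul_of_nonneg_left h1 hC2
          linarith
      _ = (|Real.log C1| + C2 * N.factorial) * Real.exp (1 / r) := by ring
      _ ≤ c * Real.exp (c / r) := by
          apply mul_le_mul (by linarith) h2 (by positivity) (by linarith)
  have h5 : 0 ≤ c * Real.exp (c / r) := by positivity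
  have h6 : Real.exp (-(c * Real.exp (c / r))) ^ 2 ≤ J := by
    refine le_trans ?_ hJ
    rw [← Real.exp_log hC1, ← Real.exp_add, ← Real.exp_nat_mul]
    apply Real.exp_le_exp.2
    push_cast
    linarith
  rw [← Real.sqrt_eq_rpow]
  exact Real.le_sqrt_of_sq_le h6

lemma ball_sub_dom {n : ℕ} {Ω : Set (Eu n)} (hΩ : IsOpen Ω) {x : Eu n} (hx : x ∈ closure Ω) {s : ℝ}
    (hs : 0 < s) (h : s ≤ infDist x (frontier Ω)) : ball x s ⊆ Ω := by
  obtain ⟨z, hz, hzx⟩ := Metric.mem_closure_iff.1 hx s hs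
  refine (convex_ball x s).isPreconnected.subset_of_closure_inter_subset hΩ
    ⟨z, by rwa [mem_ball, dist_comm], hz⟩ ?_
  rintro w ⟨hwc, hw⟩
  by_contra hwΩ
  have hwf : w ∈ frontier Ω := by rw [hΩ.frontier_eq]; exact ⟨hwc, hwΩ⟩
  have := infDist_le_dist_of_mem (x := x) hwf
  rw [mem_ball, dist_comm] at hw
  linarith

lemma cone_ball {n : ℕ} {Ω : Set (Eu n)} (hΩ : IsOpen Ω) (hf : (frontier Ω).Nonempty)
    (hcone : UniformIntConeProperty Ω) : ∃ R > 0, ∃ κ > 0, ∀ x ∈ closure Ω, ∀ r, 0 < r → r ≤ R →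
      ∃ z, ball z (κ * r) ⊆ ball x r ∩ Ω := by
  obtain ⟨R, hR, θ, hθ0, hθ1, hc⟩ := hcone
  have hcos1 : Real.cos θ < 1 := by
    have := Real.cos_lt_cos_of_nonneg_of_le_pi le_rfl (by linarith [Real.pi_pos]) hθ0
    rwa [Real.cos_zero] at this
  have hcos0 : 0 ≤ Real.cos θ := Real.cos_nonneg_of_mem_Icc ⟨by linarith, by linarith⟩
  obtain ⟨C, hC⟩ : ∃ C, C = Real.cos θ := ⟨_, rfl⟩
  rw [← hC] at hcos1 hcos0
  refine ⟨R, hR, (1 - C) / 16, by linarith, fun x hx r hr hrR => ?_⟩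
  by_cases hd : infDist x (frontier Ω) < r / 2
  · obtain ⟨xt, hxt, hxd⟩ := (infDist_lt_iff hf).1 hd
    obtain ⟨ξ, hξ, hsub⟩ := hc xt hxt
    refine ⟨xt + (r / 4) • ξ, fun y hy => ?_⟩
    rw [mem_ball, dist_eq_norm] at hy
    obtain ⟨e, he⟩ : ∃ e, e = y - (xt + (r / 4) • ξ) := ⟨_, rfl⟩
    rw [← he] at hy
    have hw : y - xt = (r / 4) • ξ + e := by rw [he]; abel
    have hn1 : ‖y - xt‖ ≤ r / 4 + ‖e‖ := by
      rw [hw]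
      refine (norm_add_le _ _).trans (le_of_eq ?_)
      rw [norm_smul, hξ, Real.norm_of_nonneg (by positivity), mul_one]
    have hin : r / 4 - ‖e‖ ≤ ⟪y - xt, ξ⟫ := by
      rw [hw, inner_add_left, real_inner_smul_left, real_inner_self_eq_norm_sq, hξ]
      have := abs_real_inner_le_norm e ξ
      rw [hξ, mul_one] at this
      have := (abs_le.1 this).1
      linarith
    have he1 : ‖e‖ < r / 16 := by nlinarith
    refine ⟨?_, hsub ⟨by linarith, ?_⟩⟩
    · rw [mem_ball]
      have := dist_triangle y xt x
      rw [dist_comm xt x, dist_eq_norm y xt] at this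
      linarith
    · rw [← hC]
      have h1 : ‖y - xt‖ * C ≤ (r / 4 + ‖e‖) * C := by gcongr
      nlinarith [norm_nonneg e]
  · push Not at hd
    refine ⟨x, subset_inter (ball_subset_ball ?_) ((ball_subset_ball ?_).trans
      (ball_sub_dom hΩ hx (half_pos hr) hd))⟩
    · nlinarith
    · nlinarith

lemma En_intOn2 {n : ℕ} {Ω : Set (Eu n)} (hΩ : IsOpen Ω) {u : Eu n → ℝ} {M : ℝ}
    (hu : ContDiffOn ℝ 2 u Ω) (b0 : ∀ x ∈ Ω, |u x| ≤ M) (b1 : ∀ x ∈ Ω, ‖fderiv ℝ u x‖ ≤ M)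
    (x : Eu n) (r : ℝ) : IntegrableOn (En u) (ball x r ∩ Ω) := by
  have hm : MeasurableSet (ball x r ∩ Ω) := measurableSet_ball.inter hΩ.measurableSet
  have hfin : volume (ball x r ∩ Ω) < ⊤ :=
    lt_of_le_of_lt (measure_mono inter_subset_left) measure_ball_lt_top
  refine IntegrableOn.of_bound hfin
    (((En_cont hΩ hu).mono inter_subset_right).aestronglyMeasurable hm) (2 * M ^ 2) ?_
  refine (ae_restrict_iff' hm).2 (Filter.Eventually.of_forall fun z hz => ?_)
  rw [Real.norm_of_nonneg (En_nonneg u z)]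
  have h0 := b0 z hz.2
  have h1 := b1 z hz.2
  have h2 : |u z| ^ 2 ≤ M ^ 2 := by gcongr
  have h3 : ‖fderiv ℝ u z‖ ^ 2 ≤ M ^ 2 := by gcongr
  rw [sq_abs] at h2
  unfold En; linarith

lemma pow_ge_exp {r : ℝ} (hr : 0 < r) (n : ℕ) : Real.exp (-((n : ℝ) * (1 / r) ^ 1)) ≤ r ^ n := by
  have h1 : 1 / r ≤ Real.exp (1 / r) := by linarith [Real.add_one_le_exp (1 / r)]
  have h2 : Real.exp (-(1 / r)) ≤ r := by
    rw [Real.exp_neg]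
    rw [inv_le_comm₀ (Real.exp_pos _) hr]; simpa using h1
  calc Real.exp (-((n : ℝ) * (1 / r) ^ 1)) = Real.exp (-(1 / r)) ^ n := by
        rw [← Real.exp_nat_mul]; congr 1; ring
    _ ≤ r ^ n := by gcongr

lemma bdry_case {n : ℕ} {Ω : Set (Eu n)} (hΩ : IsOpen Ω) (hf : (frontier Ω).Nonempty)
    (hcone : UniformIntConeProperty Ω) {η d₀ : ℝ} (hη : 0 < η) (hd₀ : 0 < d₀) :
    ∃ rs > 0, ∃ C1 > 0, ∀ u M, ContDiffOn ℝ 2 u Ω → (∀ x ∈ Ω, |u x| ≤ M) →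
      (∀ x ∈ Ω, ‖fderiv ℝ u x‖ ≤ M) →
      (∀ x ∈ closure Ω, infDist x (frontier Ω) ≤ d₀ → η ≤ |u x|) →
      ∀ x ∈ closure Ω, infDist x (frontier Ω) ≤ d₀ / 2 → ∀ r, 0 < r → r ≤ rs →
        C1 * Real.exp (-((n : ℝ) * (1 / r) ^ 1)) ≤ ∫ z in ball x r ∩ Ω, En u z := by
  obtain ⟨R, hR, κ, hκ, hc⟩ := cone_ball hΩ hf hcone
  have hV : 0 < volume.real (ball (0 : Eu n) 1) :=
    ENNReal.toReal_pos (measure_ball_pos _ _ one_pos).ne' measure_ball_lt_top.ne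
  refine ⟨min R (d₀ / 2), by positivity, η ^ 2 * (κ ^ n * volume.real (ball (0 : Eu n) 1)),
    by positivity, fun u M hu b0 b1 hus x hx hxd r hr hrs => ?_⟩
  have hr1 : r ≤ R := hrs.trans (min_le_left _ _)
  have hr2 : r ≤ d₀ / 2 := hrs.trans (min_le_right _ _)
  obtain ⟨z, hz⟩ := hc x hx r hr hr1
  have hInt := En_intOn2 hΩ hu b0 b1 x r
  have h1 : ∫ y in ball z (κ * r), En u y ≤ ∫ y in ball x r ∩ Ω, En u y :=
    setIntegral_mono_set hInt (Filter.Eventually.of_forall fun z => En_nonneg u z) hz.eventuallyLE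
  have h2 : η ^ 2 * volume.real (ball z (κ * r)) ≤ ∫ y in ball z (κ * r), En u y := by
    refine setIntegral_ge_of_const_le_real measurableSet_ball measure_ball_lt_top.ne (fun y hy => ?_)
      (hInt.mono_set hz)
    have hy' := hz hy
    have hyd : infDist y (frontier Ω) ≤ d₀ := by
      have := infDist_le_infDist_add_dist (s := frontier Ω) (x := y) (y := x)
      have := mem_ball.1 hy'.1
      linarith
    have h3 := hus y (subset_closure hy'.2) hyd
    have h4 : η ^ 2 ≤ |u y| ^ 2 := by gcongr
    rw [sq_abs] at h4
    unfold En
    have := sq_nonneg ‖fderiv ℝ u y‖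
    linarith
  have h3 : volume.real (ball z (κ * r)) = (κ * r) ^ n * volume.real (ball (0 : Eu n) 1) := by
    have h5 := Measure.addHaar_ball_of_pos (volume : Measure (Eu n)) z (r := κ * r) (by positivity)
    unfold Measure.real
    rw [h5, ENNReal.toReal_mul, ENNReal.toReal_ofReal (by positivity), finrank_euclideanSpace_fin]
  rw [h3] at h2
  have h4 := pow_ge_exp hr n
  refine le_trans ?_ (h2.trans h1)
  calc _ ≤ η ^ 2 * (κ ^ n * volume.real (ball (0 : Eu n) 1)) * r ^ n := by gcongr
    _ = _ := by rw [mul_pow]; ring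


lemma deep_case {n : ℕ} (hn : n = 2 ∨ n = 3) {Ω : Set (Eu n)} (hΩ : IsOpen Ω)
    (hΩb : Bornology.IsBounded Ω) (hΩc : IsPreconnected Ω) (hf : (frontier Ω).Nonempty)
    (A : Fin n → Fin n → Eu n → ℝ) (hA : ∀ i j, ContDiffOn ℝ 1 (A i j) Ω)
    (hsym : ∀ i j, ∀ x ∈ Ω, A i j x = A j i x) {lam Λ M : ℝ} (hlam : 0 < lam)
    (hell : ∀ x ∈ Ω, ∀ ξ : Fin n → ℝ, lam * ∑ i, ξ i ^ 2 ≤ ∑ i, ∑ j, A i j x * ξ i * ξ j)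
    (hΛ : 0 < Λ) (hM : 0 < M) {η d₀ : ℝ} (hη : 0 < η) (hd₀ : 0 < d₀) :
    ∃ rs > 0, ∃ C1 > 0, ∃ C2, 0 ≤ C2 ∧ ∃ N : ℕ, ∀ u, Adm A Ω Λ M u →
      (∀ x ∈ closure Ω, infDist x (frontier Ω) ≤ d₀ → η ≤ |u x|) →
      ∀ x ∈ closure Ω, d₀ / 2 ≤ infDist x (frontier Ω) → ∀ r, 0 < r → r ≤ rs →
        C1 * Real.exp (-(C2 * (1 / r) ^ N)) ≤ ∫ z in ball x r ∩ Ω, En u z := by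
  obtain ⟨R, hRd⟩ : ∃ R, R = min (1 / 2) (d₀ / 4) := ⟨_, rfl⟩
  have hR : 0 < R := by rw [hRd]; positivity
  have hR1 : R ≤ 1 / 2 := hRd ▸ min_le_left _ _
  have hR2 : R ≤ d₀ / 4 := hRd ▸ min_le_right _ _
  have hcomp : ∀ d : ℝ, IsCompact {y | y ∈ closure Ω ∧ d ≤ infDist y (frontier Ω)} := fun d =>
    hΩb.isCompact_closure.inter_right (isClosed_le continuous_const (continuous_infDist_pt _))
  have hKc : {y | y ∈ closure Ω ∧ d₀ / 4 ≤ infDist y (frontier Ω)} ⊆ Ω := fun y hy =>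
    ball_sub_dom hΩ hy.1 (by positivity) hy.2 (mem_ball_self (by positivity))
  have hcb : ∀ x ∈ closure Ω, d₀ / 2 ≤ infDist x (frontier Ω) → closedBall x R ⊆
      {y | y ∈ closure Ω ∧ d₀ / 4 ≤ infDist y (frontier Ω)} := by
    intro x hx hxd y hy
    rw [mem_closedBall] at hy
    refine ⟨subset_closure (ball_sub_dom hΩ hx (half_pos hd₀) hxd ?_), ?_⟩
    · rw [mem_ball]; linarith
    · have := infDist_le_infDist_add_dist (s := frontier Ω) (x := x) (y := y)
      rw [dist_comm] at this
      linarith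
  obtain ⟨N, C, hC, g0, hg0, hloc⟩ := local_prop hn hΩ A hA hsym hlam hell hΛ hM hR hR1
      (hcomp (d₀ / 4)) hKc
  -- a ball in the boundary strip
  obtain ⟨xf, hxf⟩ := hf
  obtain ⟨y0, hy0, hy0d⟩ := Metric.mem_closure_iff.1 (frontier_subset_closure hxf) (d₀ / 2)
    (half_pos hd₀)
  obtain ⟨s, hs, hys⟩ := Metric.isOpen_iff.1 hΩ y0 hy0
  obtain ⟨β, hβd⟩ : ∃ β, β = min (s / 2) (d₀ / 2) := ⟨_, rfl⟩
  have hβ : 0 < β := by rw [hβd]; positivity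
  have hβ1 : β ≤ s / 2 := hβd ▸ min_le_left _ _
  have hβ2 : β ≤ d₀ / 2 := hβd ▸ min_le_right _ _
  have hyβ : closedBall y0 β ⊆ Ω := (closedBall_subset_ball (by linarith)).trans hys
  obtain ⟨δ, hδ, hq⟩ := qual hn hΩ hΩc A hA hsym hlam hell hΛ hM (hcomp (d₀ / 2))
    (ρ := R / 4) (by positivity) (fun x hx => (closedBall_subset_closedBall (by linarith)).trans
      ((hcb x hx.1 hx.2).trans hKc)) hβ hyβ hη
  have hτ : ∃ τ, C ≤ τ ∧ C * Real.exp (-(g0 * τ)) < δ / 2 := by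
    have ht : Filter.Tendsto (fun τ => C * Real.exp (-(g0 * τ))) Filter.atTop (nhds (C * 0)) := by
      refine Filter.Tendsto.const_mul C (Real.tendsto_exp_neg_atTop_nhds_zero.comp ?_)
      exact Filter.tendsto_id.const_mul_atTop hg0
    rw [mul_zero] at ht
    obtain ⟨τ, h1, h2⟩ := ((Filter.eventually_ge_atTop C).and
      (ht.eventually (gt_mem_nhds (half_pos hδ)))).exists
    exact ⟨τ, h1, h2⟩
  obtain ⟨τ, hτC, hτδ⟩ := hτ
  have hτ0 : 0 < τ := by linarith
  refine ⟨R / 4, by positivity, δ / 2, by positivity, C * τ, by positivity, N,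
    fun u hu hus x hx hxd r hr hrs => ?_⟩
  have h1 := hloc u hu x (hcb x hx hxd) r hr hrs τ hτC
  have h2 := hq u hu (fun y hy => hus y (subset_closure (hyβ (ball_subset_closedBall hy))) (by
    have h3 := infDist_le_dist_of_mem (x := y) hxf
    have h4 := dist_triangle y y0 xf
    rw [dist_comm y0 xf] at h4
    have := mem_ball.1 hy
    linarith)) x ⟨hx, hxd⟩
  have hsub : ball x r ⊆ Ω := (ball_subset_closedBall.trans
    (closedBall_subset_closedBall (by linarith))).trans ((hcb x hx hxd).trans hKc)
  rw [inter_eq_left.2 hsub]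
  rw [Real.exp_neg, ← div_eq_mul_inv, div_le_iff₀ (Real.exp_pos _)]
  linarith

theorem stmt_11 {n : ℕ} (hn : n = 2 ∨ n = 3)
    (Ω : Set (EuclideanSpace ℝ (Fin n)))
    (hΩo : IsOpen Ω) (hΩb : Bornology.IsBounded Ω) (hΩc : IsConnected Ω)
    (hcone : UniformIntConeProperty Ω)
    (m : ℕ) (hm : 0 < m) (hbl : BrokenLineCond Ω m)
    (A : Fin n → Fin n → EuclideanSpace ℝ (Fin n) → ℝ) (hA : EllipticSym Ω A)
    (Λ M η d₀ : ℝ) (hΛ : 0 < Λ) (hM : 0 < M) (hη : 0 < η) (hd₀ : 0 < d₀) :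
    ∃ c > 0, ∃ rs > 0, ∀ q u : EuclideanSpace ℝ (Fin n) → ℝ,
      Measurable q → (∀ᵐ x ∂(volume.restrict Ω), |q x| ≤ Λ) →
      ContDiffOn ℝ 2 u Ω → C1BoundOn Ω u M → IsSolution A q u Ω →
      (∀ x ∈ closure Ω, infDist x (frontier Ω) ≤ d₀ → η ≤ |u x|) →
      ∀ x ∈ closure Ω, ∀ r : ℝ, 0 < r → r ≤ rs →
        Real.exp (-(c * Real.exp (c / r))) ≤ H1Norm (ball x r ∩ Ω) u := by
  obtain ⟨hsym, hAc, lam, hlam, hell⟩ := hA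
  have hAΩ : ∀ i j, ContDiffOn ℝ 1 (A i j) Ω := fun i j => (hAc i j).mono subset_closure
  have hsymΩ : ∀ i j, ∀ x ∈ Ω, A i j x = A j i x := fun i j x hx =>
    hsym i j x (subset_closure hx)
  have hellΩ : ∀ x ∈ Ω, ∀ ξ : Fin n → ℝ,
      lam * ∑ i, ξ i ^ 2 ≤ ∑ i, ∑ j, A i j x * ξ i * ξ j := by
    intro x hx ξ
    have h := hell x hx (WithLp.toLp 2 ξ)
    rw [EuclideanSpace.norm_sq_eq] at h
    simpa using h
  have hf : (frontier Ω).Nonempty := by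
    haveI : Nontrivial (EuclideanSpace ℝ (Fin n)) := by
      rcases hn with rfl | rfl <;> infer_instance
    refine nonempty_frontier_iff.2 ⟨hΩc.nonempty, fun h => ?_⟩
    rw [h] at hΩb
    exact NormedSpace.unbounded_univ ℝ (EuclideanSpace ℝ (Fin n)) hΩb
  obtain ⟨r1, hr1, B1, hB1, hb⟩ := bdry_case hΩo hf hcone hη hd₀
  obtain ⟨r2, hr2, D1, hD1, D2, hD2, N, hd⟩ := deep_case hn hΩo hΩb hΩc.isPreconnected hf A hAΩ
    hsymΩ hlam hellΩ hΛ hM hη hd₀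
  obtain ⟨c1, hc1, hn1⟩ := num_lem hB1 (Nat.cast_nonneg n) 1
  obtain ⟨c2, hc2, hn2⟩ := num_lem hD1 hD2 N
  refine ⟨max c1 c2, lt_max_of_lt_left hc1, min r1 r2, lt_min hr1 hr2,
    fun q u _ hq hu hC1 hsol hus x hx r hr hrs => ?_⟩
  have hadm : Adm A Ω Λ M u := ⟨hu, Lop_le hΩo A hAΩ hu hsol hq,
    fun y hy => hC1.2.1 y (subset_closure hy), hC1.2.2⟩
  rcases le_total (infDist x (frontier Ω)) (d₀ / 2) with h | h
  · exact hn1 _ (le_max_left _ _) r _ hr (hb u M hu hadm.b0 hadm.b1 hus x hx h r hr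
      (hrs.trans (min_le_left _ _)))
  · exact hn2 _ (le_max_right _ _) r _ hr (hd u hadm hus x hx h r hr
      (hrs.trans (min_le_right _ _)))
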